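/- Let T be a rooted ternary tree with n leaves labeled 1,…,n in left-to-right order, each internal node v carrying strengths 0 < s_{L,v} < s_{C,v} < s_{R,v} with s_{L,v}/s_{C,v} < 1/2 and s_{C,v}/s_{R,v} < 1/2. Let L_3 and M_tree be the league hierarchy chain and the tree chain on S_n determined by T. Then there is a constant C, depending only on the ratios of the strengths at internal nodes of T, such that t(L_3) ≤ C·n^4·t(M_tree). -/

import Mathlib

open Finset

/-- Total-variation mixing time: the least `T` such that for every starting state `x`
and every `t ≥ T`, the TV distance between `P^t(x, ·)` and `π` is at most `1/4`. -/
noncomputable def mixingTime {Ω : Type*} [Fintype Ω] [DecidableEq Ω]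
    (P : Matrix Ω Ω ℝ) (π : Ω → ℝ) : ℕ :=
  sInf {T : ℕ | ∀ x : Ω, ∀ t : ℕ, T ≤ t →
    (1 / 2) * ∑ y : Ω, |(P ^ t) x y - π y| ≤ 1 / 4}



/-- A rooted ternary tree; each internal node carries strengths
`sL, sC, sR` for its left, center and right child slots. -/
inductive STree : Type
  | leaf : STree
  | node (sL sC sR : ℝ) (l c r : STree) : STree

namespace STree

/-- Number of leaves of a ternary tree. -/
def numLeaves : STree → ℕ
  | .leaf => 1
  | .node _ _ _ l c r => l.numLeaves + c.numLeaves + r.numLeaves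

/-- `pSwap T i j` is the probability `p_{i,j}` (for leaves `i < j`, 0-indexed
left-to-right) of putting `i` ahead of `j`:  `s_{X,v}/(s_{X,v}+s_{Y,v})` where `v` is
the lowest common ancestor, `X` the child slot of `v` containing `j`, `Y` that
containing `i`. -/
noncomputable def pSwap : STree → ℕ → ℕ → ℝ
  | .leaf, _, _ => 0
  | .node sL sC sR l c r, i, j =>
    if j < l.numLeaves then pSwap l i j
    else if i < l.numLeaves then
      if j < l.numLeaves + c.numLeaves then sC / (sC + sL) else sR / (sR + sL)
    else if j < l.numLeaves + c.numLeaves then pSwap c (i - l.numLeaves) (j - l.numLeaves)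
    else if i < l.numLeaves + c.numLeaves then sR / (sR + sC)
    else pSwap r (i - l.numLeaves - c.numLeaves) (j - l.numLeaves - c.numLeaves)

/-- Every internal node has strengths `0 < s_L < s_C < s_R` with
`s_L/s_C < 1/2` and `s_C/s_R < 1/2`. -/
def Valid : STree → Prop
  | .leaf => True
  | .node sL sC sR l c r =>
      0 < sL ∧ sL < sC ∧ sC < sR ∧ sL / sC < 1 / 2 ∧ sC / sR < 1 / 2 ∧
        l.Valid ∧ c.Valid ∧ r.Valid

/-- All strength ratios at internal nodes are bounded by `qb`. -/
def RatioBound (qb : ℝ) : STree → Prop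
  | .leaf => True
  | .node sL sC sR l c r =>
      sL / sC ≤ qb ∧ sC / sR ≤ qb ∧
        l.RatioBound qb ∧ c.RatioBound qb ∧ r.RatioBound qb

/-- `lcaRange T i j` is the (inclusive) interval of 0-indexed leaf positions of the
subtree rooted at the lowest common ancestor of leaves `i ≤ j`. -/
def lcaRange : STree → ℕ → ℕ → ℕ × ℕ
  | .leaf, _, _ => (0, 0)
  | .node _ _ _ l c r, i, j =>
    if j < l.numLeaves then lcaRange l i j
    else if l.numLeaves ≤ i ∧ j < l.numLeaves + c.numLeaves then
      ((lcaRange c (i - l.numLeaves) (j - l.numLeaves)).1 + l.numLeaves,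
       (lcaRange c (i - l.numLeaves) (j - l.numLeaves)).2 + l.numLeaves)
    else if l.numLeaves + c.numLeaves ≤ i then
      ((lcaRange r (i - l.numLeaves - c.numLeaves) (j - l.numLeaves - c.numLeaves)).1
          + l.numLeaves + c.numLeaves,
       (lcaRange r (i - l.numLeaves - c.numLeaves) (j - l.numLeaves - c.numLeaves)).2
          + l.numLeaves + c.numLeaves)
    else (0, l.numLeaves + c.numLeaves + r.numLeaves - 1)

end STree

/-- Transition matrix of the league hierarchy chain `L₃` on `S_n`,
`n` the number of leaves of `T` (leaves labeled `0,…,n-1` left to right). -/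
noncomputable def leagueP (T : STree) :
    Matrix (Equiv.Perm (Fin T.numLeaves)) (Equiv.Perm (Fin T.numLeaves)) ℝ :=
  fun σ τ => (1 / ((T.numLeaves : ℝ) - 1)) *
    ∑ i : Fin T.numLeaves, ∑ j : Fin T.numLeaves,
      if (j : ℕ) = (i : ℕ) + 1 then
        (T.pSwap (min (σ i : ℕ) (σ j : ℕ)) (max (σ i : ℕ) (σ j : ℕ))) *
          (if τ = (if (σ i : ℕ) ≤ (σ j : ℕ) then σ else σ * Equiv.swap i j) then 1 else 0)
        + (1 - T.pSwap (min (σ i : ℕ) (σ j : ℕ)) (max (σ i : ℕ) (σ j : ℕ))) *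
          (if τ = (if (σ i : ℕ) ≤ (σ j : ℕ) then σ * Equiv.swap i j else σ) then 1 else 0)
      else 0

/-- Transition matrix of the chain `M_tree` on `S_n`. -/
noncomputable def treeP (T : STree) :
    Matrix (Equiv.Perm (Fin T.numLeaves)) (Equiv.Perm (Fin T.numLeaves)) ℝ :=
  fun σ τ => (1 / ((T.numLeaves).choose 2 : ℝ)) *
    ∑ i : Fin T.numLeaves, ∑ j : Fin T.numLeaves,
      if i < j then
        if ∀ l, i < l → l < j →
            ¬((T.lcaRange (min (σ i : ℕ) (σ j : ℕ)) (max (σ i : ℕ) (σ j : ℕ))).1 ≤ (σ l : ℕ) ∧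
              (σ l : ℕ) ≤ (T.lcaRange (min (σ i : ℕ) (σ j : ℕ)) (max (σ i : ℕ) (σ j : ℕ))).2) then
          (T.pSwap (min (σ i : ℕ) (σ j : ℕ)) (max (σ i : ℕ) (σ j : ℕ))) *
            (if τ = (if (σ i : ℕ) ≤ (σ j : ℕ) then σ else σ * Equiv.swap i j) then 1 else 0)
          + (1 - T.pSwap (min (σ i : ℕ) (σ j : ℕ)) (max (σ i : ℕ) (σ j : ℕ))) *
            (if τ = (if (σ i : ℕ) ≤ (σ j : ℕ) then σ * Equiv.swap i j else σ) then 1 else 0)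
        else (if τ = σ then 1 else 0)
      else 0

/-- Unnormalized stationary weight common to `L₃` and `M_tree`:
`∏_{u<v, v before u in σ} (1-p_{u,v})/p_{u,v}`. -/
noncomputable def treeW (T : STree) (σ : Equiv.Perm (Fin T.numLeaves)) : ℝ :=
  ∏ u : Fin T.numLeaves, ∏ v : Fin T.numLeaves,
    if u < v ∧ σ.symm v < σ.symm u then
      (1 - T.pSwap (u : ℕ) (v : ℕ)) / T.pSwap (u : ℕ) (v : ℕ)
    else 1

/-- Common stationary distribution of `L₃` and `M_tree`. -/
noncomputable def treePi (T : STree) (σ : Equiv.Perm (Fin T.numLeaves)) : ℝ :=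
  treeW T σ / ∑ τ : Equiv.Perm (Fin T.numLeaves), treeW T τ

/-- A stochastic matrix reversible with respect to a positive probability vector. -/
structure IsReversibleChain {Ω : Type*} [Fintype Ω] (P : Matrix Ω Ω ℝ) (π : Ω → ℝ) : Prop where
  nonneg : ∀ x y, 0 ≤ P x y
  row_sum : ∀ x, ∑ y, P x y = 1
  reversible : ∀ x y, π x * P x y = π y * P y x
  pos : ∀ x, 0 < π x
  sum_eq_one : ∑ x, π x = 1

/-- Variance of `f` under the probability vector `π`. -/
def chainVar {Ω : Type*} [Fintype Ω] (π f : Ω → ℝ) : ℝ :=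
  ∑ x, π x * f x ^ 2 - (∑ x, π x * f x) ^ 2

/-- Dirichlet form `⟨f, f⟩ - ⟨f, P f⟩` of the chain `P`. -/
def chainEnergy {Ω : Type*} [Fintype Ω] (P : Matrix Ω Ω ℝ) (π f : Ω → ℝ) : ℝ :=
  ∑ x, π x * f x ^ 2 - ∑ x, π x * (f x * (P.mulVec f) x)

namespace IsReversibleChain

variable {Ω : Type*} [Fintype Ω] {P : Matrix Ω Ω ℝ} {π : Ω → ℝ}

lemma sum_mul_mulVec (h : IsReversibleChain P π) (f g : Ω → ℝ) :
    ∑ x, π x * (g x * (P.mulVec f) x) = ∑ x, π x * ((P.mulVec g) x * f x) := by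
  simp only [Matrix.mulVec, dotProduct, Finset.mul_sum, Finset.sum_mul]
  rw [Finset.sum_comm]
  refine Finset.sum_congr rfl fun y _ => Finset.sum_congr rfl fun x _ => ?_
  linear_combination (g x * f y) * h.reversible x y

lemma mulVec_const (h : IsReversibleChain P π) (c : ℝ) :
    P.mulVec (fun _ => c) = fun _ => c := by
  ext x
  simp [Matrix.mulVec, dotProduct, ← Finset.sum_mul, h.row_sum]

lemma sum_mulVec (h : IsReversibleChain P π) (f : Ω → ℝ) :
    ∑ x, π x * (P.mulVec f) x = ∑ x, π x * f x := by
  have := h.sum_mul_mulVec f (fun _ => 1)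
  simpa [h.mulVec_const] using this

lemma stationary (h : IsReversibleChain P π) (y : Ω) : ∑ x, π x * P x y = π y := by
  simp_rw [h.reversible _ y, ← Finset.mul_sum, h.row_sum, mul_one]

variable [DecidableEq Ω]

lemma pow_reversible (h : IsReversibleChain P π) (t : ℕ) (x y : Ω) :
    π x * (P ^ t) x y = π y * (P ^ t) y x := by
  induction t generalizing x y with
  | zero =>
    by_cases hxy : x = y
    · subst hxy; rfl
    · simp [hxy, Ne.symm hxy]
  | succ t ih =>
    rw [pow_succ, Matrix.mul_apply, ← pow_succ, pow_succ', Matrix.mul_apply, Finset.mul_sum,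
      Finset.mul_sum]
    refine Finset.sum_congr rfl fun z _ => ?_
    linear_combination (P z y) * ih x z + (P ^ t) z x * h.reversible z y

lemma pow (h : IsReversibleChain P π) (t : ℕ) : IsReversibleChain (P ^ t) π where
  nonneg := by
    induction t with
    | zero => intro x y; simp only [pow_zero, Matrix.one_apply]; split_ifs <;> norm_num
    | succ t ih =>
      intro x y
      rw [pow_succ, Matrix.mul_apply]
      exact Finset.sum_nonneg fun z _ => mul_nonneg (ih _ _) (h.nonneg _ _)
  row_sum := by
    induction t with
    | zero => intro x; simp [Matrix.one_apply]
    | succ t ih =>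
      intro x
      simp only [pow_succ, Matrix.mul_apply]
      rw [Finset.sum_comm]
      simp [← Finset.mul_sum, h.row_sum, ih]
  reversible := h.pow_reversible t
  pos := h.pos
  sum_eq_one := h.sum_eq_one

end IsReversibleChain

lemma chainVar_eq_sum_sq {Ω : Type*} [Fintype Ω] {π : Ω → ℝ} (hπ : ∑ x, π x = 1) (f : Ω → ℝ)
    (c : ℝ) : ∑ x, π x * (f x - c) ^ 2 = chainVar π f + (∑ x, π x * f x - c) ^ 2 := by
  have : ∀ x, π x * (f x - c) ^ 2 = π x * f x ^ 2 - 2 * c * (π x * f x) + c ^ 2 * π x := by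
    intro x; ring
  simp only [this, Finset.sum_add_distrib, Finset.sum_sub_distrib, ← Finset.mul_sum, hπ, chainVar]
  ring

lemma chainVar_nonneg {Ω : Type*} [Fintype Ω] {π : Ω → ℝ} (hπ : ∑ x, π x = 1)
    (hpos : ∀ x, 0 < π x) (f : Ω → ℝ) : 0 ≤ chainVar π f := by
  have := chainVar_eq_sum_sq hπ f (∑ x, π x * f x)
  rw [sub_self] at this
  have h2 : 0 ≤ ∑ x, π x * (f x - ∑ x, π x * f x) ^ 2 :=
    Finset.sum_nonneg fun x _ => mul_nonneg (hpos x).le (sq_nonneg _)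
  linarith [this, sq_nonneg (0 : ℝ)]

namespace IsReversibleChain

variable {Ω : Type*} [Fintype Ω] {P : Matrix Ω Ω ℝ} {π : Ω → ℝ}

lemma chainVar_mulVec_le (h : IsReversibleChain P π)
    (hpsd : ∀ f, ∑ x, π x * (P.mulVec f) x ^ 2 ≤ ∑ x, π x * (f x * (P.mulVec f) x))
    {R : ℝ} (hR : 0 < R) (hgap : ∀ f, chainVar π f ≤ R * chainEnergy P π f) (f : Ω → ℝ) :
    chainVar π (P.mulVec f) ≤ Real.exp (-1 / R) * chainVar π f := by
  have h1 : chainVar π (P.mulVec f) ≤ chainVar π f - chainEnergy P π f := by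
    unfold chainVar chainEnergy
    rw [h.sum_mulVec]
    linarith [hpsd f]
  have h2 : chainVar π f / R ≤ chainEnergy P π f := by
    rw [div_le_iff₀ hR]; linarith [hgap f]
  have h3 : chainVar π f - chainVar π f / R ≤ Real.exp (-1 / R) * chainVar π f := by
    have := Real.add_one_le_exp (-1 / R)
    have h0 := chainVar_nonneg h.sum_eq_one h.pos f
    calc _ = (-1 / R + 1) * chainVar π f := by ring
      _ ≤ _ := by gcongr
  linarith

variable [DecidableEq Ω]

/-- A Poincaré inequality for a positive semidefinite reversible chain bounds its distance to
stationarity. -/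
lemma sum_abs_sub_le_of_gap (h : IsReversibleChain P π)
    (hpsd : ∀ f, ∑ x, π x * (P.mulVec f) x ^ 2 ≤ ∑ x, π x * (f x * (P.mulVec f) x))
    {R : ℝ} (hR : 0 < R) (hgap : ∀ f, chainVar π f ≤ R * chainEnergy P π f) (x : Ω) (t : ℕ) :
    (∑ y, |(P ^ t) x y - π y|) ^ 2 ≤ Real.exp (-t / R) / π x := by
  have hne : ∀ y, π y ≠ 0 := fun y => (h.pos y).ne'
  set g : ℕ → Ω → ℝ := fun s y => (P ^ s) x y / π y with hg
  have hstep : ∀ s, g (s + 1) = P.mulVec (g s) := by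
    intro s
    ext y
    simp only [hg, Matrix.mulVec, dotProduct, pow_succ, Matrix.mul_apply, Finset.sum_div]
    refine Finset.sum_congr rfl fun z _ => ?_
    rw [div_eq_iff (hne y), mul_div_assoc', div_mul_eq_mul_div, eq_div_iff (hne z)]
    linear_combination (P ^ s) x z * h.reversible z y
  have hvar : ∀ s : ℕ, chainVar π (g s) ≤ Real.exp (-s / R) / π x := by
    intro s
    induction s with
    | zero =>
      unfold chainVar
      have e : ∑ y, π y * g 0 y ^ 2 = 1 / π x := by
        rw [Finset.sum_eq_single x]
        · simp [hg]; field_simp [hne x]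
        · intro y _ hy; simp [hg, Ne.symm hy]
        · simp
      rw [e]
      simp only [Nat.cast_zero, neg_zero, zero_div, Real.exp_zero]
      linarith [sq_nonneg (∑ y, π y * g 0 y)]
    | succ s ih =>
      rw [hstep]
      refine (h.chainVar_mulVec_le hpsd hR hgap _).trans ?_
      calc _ ≤ Real.exp (-1 / R) * (Real.exp (-s / R) / π x) := by gcongr
        _ = _ := by
          rw [mul_div_assoc', ← Real.exp_add]; congr 2; push_cast; ring
  have hmean : ∑ y, π y * g t y = 1 := by
    rw [← (h.pow t).row_sum x]
    refine Finset.sum_congr rfl fun y _ => ?_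
    simp only [hg]; field_simp [hne y]
  have hcs : (∑ y, |(P ^ t) x y - π y|) ^ 2 ≤ (∑ y, π y) * ∑ y, π y * (g t y - 1) ^ 2 := by
    refine Finset.sum_sq_le_sum_mul_sum_of_sq_le_mul _ (fun y _ => (h.pos y).le)
      (fun y _ => mul_nonneg (h.pos y).le (sq_nonneg _)) fun y _ => ?_
    rw [sq_abs]
    simp only [hg]
    refine le_of_eq ?_
    field_simp [hne y]
  rw [h.sum_eq_one, one_mul, chainVar_eq_sum_sq h.sum_eq_one, hmean] at hcs
  linarith [hvar t]

/-- A contraction of the total variation distance between two trajectories after `t` steps gives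
a Poincaré inequality with constant `4 t`. -/
lemma gap_of_contraction (h : IsReversibleChain P π) {t : ℕ} (ht : 0 < t)
    (hc : ∀ x y, ∑ z, |(P ^ t) x z - (P ^ t) y z| ≤ 3 / 2) (f : Ω → ℝ) :
    chainVar π f ≤ 4 * t * chainEnergy P π f := by
  obtain ⟨x₀⟩ : Nonempty Ω := by
    by_contra hne
    rw [not_nonempty_iff] at hne
    simpa using h.sum_eq_one
  have hosc : ∀ (g : Ω → ℝ) (c : ℝ), (∀ x y, |g x - g y| ≤ c) →
      ∀ x y, |((P ^ t).mulVec g) x - ((P ^ t).mulVec g) y| ≤ 3 / 4 * c := by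
    intro g c hgc x y
    obtain ⟨a, -, ha⟩ := Finset.exists_max_image Finset.univ g ⟨x₀, Finset.mem_univ _⟩
    obtain ⟨b, -, hb⟩ := Finset.exists_min_image Finset.univ g ⟨x₀, Finset.mem_univ _⟩
    set m := (g a + g b) / 2
    have hm : ∀ z, |g z - m| ≤ c / 2 := by
      intro z
      have h1 := ha z (Finset.mem_univ _)
      have h2 := hb z (Finset.mem_univ _)
      have h3 := (abs_le.1 (hgc a b)).2
      rw [abs_le]; constructor <;> simp only [m] <;> linarith
    have e : ((P ^ t).mulVec g) x - ((P ^ t).mulVec g) y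
        = ∑ z, ((P ^ t) x z - (P ^ t) y z) * (g z - m) := by
      have hx := (h.pow t).row_sum x
      have hy := (h.pow t).row_sum y
      simp only [Matrix.mulVec, dotProduct, mul_sub, sub_mul, Finset.sum_sub_distrib,
        ← Finset.sum_mul, hx, hy]
      ring
    rw [e]
    calc _ ≤ ∑ z, |((P ^ t) x z - (P ^ t) y z) * (g z - m)| := Finset.abs_sum_le_sum_abs _ _
      _ ≤ ∑ z, |(P ^ t) x z - (P ^ t) y z| * (c / 2) := by
        refine Finset.sum_le_sum fun z _ => ?_
        rw [abs_mul]; gcongr; exact hm z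
      _ ≤ 3 / 2 * (c / 2) := by
        rw [← Finset.sum_mul]
        have hc0 : 0 ≤ c := (abs_nonneg _).trans (hgc x₀ x₀)
        gcongr; exact hc x y
      _ = _ := by ring
  set μ := ∑ x, π x * f x with hμ
  set g : ℕ → Ω → ℝ := fun s => (P ^ s).mulVec (fun x => f x - μ) with hg
  have hgs : ∀ s, g (s + 1) = P.mulVec (g s) := by
    intro s; simp only [hg, Matrix.mulVec_mulVec, pow_succ']
  have hmean : ∀ s, ∑ x, π x * g s x = 0 := by
    intro s
    rw [(h.pow s).sum_mulVec]
    simp [mul_sub, Finset.sum_sub_distrib, ← Finset.sum_mul, h.sum_eq_one, hμ]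
  set b : ℕ → ℝ := fun s => ∑ x, π x * g s x ^ 2 with hb
  have hb0 : ∀ s, 0 ≤ b s := fun s =>
    Finset.sum_nonneg fun x _ => mul_nonneg (h.pos x).le (sq_nonneg _)
  have hcs : ∀ u v : Ω → ℝ,
      (∑ x, π x * (u x * v x)) ^ 2 ≤ (∑ x, π x * u x ^ 2) * ∑ x, π x * v x ^ 2 := by
    intro u v
    refine Finset.sum_sq_le_sum_mul_sum_of_sq_le_mul _
      (fun y _ => mul_nonneg (h.pos y).le (sq_nonneg _))
      (fun y _ => mul_nonneg (h.pos y).le (sq_nonneg _)) fun y _ => le_of_eq (by ring)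
  have hlog : ∀ s, b (s + 1) ^ 2 ≤ b s * b (s + 2) := by
    intro s
    have e : b (s + 1) = ∑ x, π x * (g s x * g (s + 2) x) := by
      rw [hgs (s + 1), h.sum_mul_mulVec, ← hgs s]
      exact Finset.sum_congr rfl fun x _ => by ring
    rw [e]; exact hcs _ _
  have hE : chainEnergy P π f = b 0 - ∑ x, π x * (g 0 x * g 1 x) := by
    have e0 : g 0 = fun x => f x - μ := by simp [hg]
    have e1 : g 1 = fun x => (P.mulVec f) x - μ := by
      rw [hgs 0, e0]
      ext x
      have := congrFun (h.mulVec_const μ) x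
      simp only [Matrix.mulVec, dotProduct, mul_sub, Finset.sum_sub_distrib] at this ⊢
      rw [this]
    have h2 := h.sum_mulVec f
    have e2 : ∀ x, π x * ((f x - μ) * ((P.mulVec f) x - μ)) = π x * (f x * (P.mulVec f) x)
      - μ * (π x * f x) - μ * (π x * (P.mulVec f) x) + μ ^ 2 * π x := by intro x; ring
    simp only [hb, e1, e2, e0]
    rw [chainVar_eq_sum_sq h.sum_eq_one]
    simp only [Finset.sum_add_distrib, Finset.sum_sub_distrib, ← Finset.mul_sum, h2,
      h.sum_eq_one, chainVar, chainEnergy, ← hμ]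
    ring
  have hV : chainVar π f = b 0 := by
    have e0 : g 0 = fun x => f x - μ := by simp [hg]
    simp only [hb, e0]
    rw [chainVar_eq_sum_sq h.sum_eq_one, ← hμ]; ring
  rw [hV, hE]
  rcases (hb0 0).eq_or_lt with h0 | h0
  · have := hcs (g 0) (g 1)
    change _ ≤ b 0 * _ at this
    rw [← h0, zero_mul] at this
    have : ∑ x, π x * (g 0 x * g 1 x) = 0 := pow_eq_zero_iff two_ne_zero |>.1
      (le_antisymm this (sq_nonneg _))
    rw [this, ← h0]; simp
  set θ := √(b 1 / b 0) with hθ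
  have hθ2 : θ ^ 2 = b 1 / b 0 := Real.sq_sqrt (div_nonneg (hb0 1) h0.le)
  have hθ0 : 0 ≤ θ := Real.sqrt_nonneg _
  have hinner : ∑ x, π x * (g 0 x * g 1 x) ≤ θ * b 0 := by
    refine abs_le_of_sq_le_sq' ?_ (by positivity) |>.2
    calc _ ≤ b 0 * b 1 := hcs _ _
      _ = _ := by rw [mul_pow, hθ2]; field_simp
  have hratio : ∀ s, θ ^ 2 * b s ≤ b (s + 1) ∧ (0 < θ → 0 < b s) := by
    intro s
    induction s with
    | zero => exact ⟨by rw [hθ2]; field_simp; exact le_rfl, fun _ => h0⟩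
    | succ s ih =>
      rcases hθ0.eq_or_lt with h1 | h1
      · rw [← h1]; simpa using hb0 _
      · have hs := ih.2 h1
        have hs1 : 0 < b (s + 1) := lt_of_lt_of_le (by positivity) ih.1
        refine ⟨?_, fun _ => hs1⟩
        have := hlog s
        by_contra! hlt
        have : b s * b (s + 2) < b s * (θ ^ 2 * b (s + 1)) := by gcongr
        nlinarith [ih.1]
  have hpow : ∀ s, (θ ^ 2) ^ s * b 0 ≤ b s := by
    intro s
    induction s with
    | zero => simp
    | succ s ih =>
      calc _ = θ ^ 2 * ((θ ^ 2) ^ s * b 0) := by ring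
        _ ≤ θ ^ 2 * b s := by gcongr
        _ ≤ _ := (hratio s).1
  obtain ⟨c, hc1⟩ : ∃ c, ∀ x y, |g 0 x - g 0 y| ≤ c := by
    refine ⟨∑ x, ∑ y, |g 0 x - g 0 y|, fun x y => ?_⟩
    refine (Finset.single_le_sum (f := fun y => |g 0 x - g 0 y|) (fun _ _ => abs_nonneg _)
      (Finset.mem_univ y)).trans ?_
    exact Finset.single_le_sum (f := fun x => ∑ y, |g 0 x - g 0 y|)
      (fun _ _ => Finset.sum_nonneg fun _ _ => abs_nonneg _) (Finset.mem_univ x)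
  have hck : ∀ k, ∀ x y, |g (t * k) x - g (t * k) y| ≤ (3 / 4) ^ k * c := by
    intro k
    induction k with
    | zero => simpa using hc1
    | succ k ih =>
      have : g (t * (k + 1)) = (P ^ t).mulVec (g (t * k)) := by
        simp only [hg, Matrix.mulVec_mulVec, ← pow_add]; congr 2; ring
      rw [this, pow_succ']
      intro x y
      refine (hosc _ _ ih x y).trans (le_of_eq (by ring))
  have hbk : ∀ k, b (t * k) ≤ ((3 / 4) ^ k * c) ^ 2 := by
    intro k
    have hle : ∀ x, |g (t * k) x| ≤ (3 / 4) ^ k * c := by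
      intro x
      have e : g (t * k) x = ∑ y, π y * (g (t * k) x - g (t * k) y) := by
        simp only [mul_sub, Finset.sum_sub_distrib, ← Finset.sum_mul, h.sum_eq_one, hmean]; ring
      rw [e]
      calc _ ≤ ∑ y, |π y * (g (t * k) x - g (t * k) y)| := Finset.abs_sum_le_sum_abs _ _
        _ ≤ ∑ y, π y * ((3 / 4) ^ k * c) := by
          refine Finset.sum_le_sum fun y _ => ?_
          rw [abs_mul, abs_of_pos (h.pos y)]
          exact mul_le_mul_of_nonneg_left (hck k x y) (h.pos y).le
        _ = _ := by rw [← Finset.sum_mul, h.sum_eq_one, one_mul]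
    calc b (t * k) ≤ ∑ y, π y * ((3 / 4) ^ k * c) ^ 2 := by
          refine Finset.sum_le_sum fun y _ => ?_
          exact mul_le_mul_of_nonneg_left (sq_le_sq' (abs_le.1 (hle y)).1 (abs_le.1 (hle y)).2)
            (h.pos y).le
      _ = _ := by rw [← Finset.sum_mul, h.sum_eq_one, one_mul]
  have hθt : θ ^ t ≤ 3 / 4 := by
    by_contra! hlt
    have hlim : Filter.Tendsto (fun k : ℕ => (θ ^ t / (3 / 4)) ^ k) Filter.atTop Filter.atTop :=
      tendsto_pow_atTop_atTop_of_one_lt (by rw [lt_div_iff₀] <;> linarith)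
    obtain ⟨k, hk⟩ := (hlim.eventually_gt_atTop (|c| / √(b 0))).exists
    have h1 : (θ ^ t) ^ k * √(b 0) ≤ (3 / 4) ^ k * |c| := by
      refine abs_le_of_sq_le_sq' ?_ (by positivity) |>.2
      calc _ = (θ ^ 2) ^ (t * k) * b 0 := by
            rw [mul_pow, Real.sq_sqrt h0.le]; ring
        _ ≤ b (t * k) := hpow _
        _ ≤ _ := hbk k
        _ = _ := by rw [mul_pow, mul_pow, sq_abs]
    rw [div_lt_iff₀ (Real.sqrt_pos.2 h0), div_pow, div_mul_eq_mul_div, lt_div_iff₀ (by positivity)]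
      at hk
    linarith
  have hbern := one_add_mul_le_pow (a := θ - 1) (by linarith) t
  have hbern' : 1 + t * (θ - 1) ≤ 3 / 4 := hbern.trans (by simpa using hθt)
  have : (1 : ℝ) * b 0 ≤ (4 * t * (1 - θ)) * b 0 := by
    gcongr; linarith
  have ht' : (0 : ℝ) < t := by exact_mod_cast ht
  nlinarith [mul_le_mul_of_nonneg_left hinner ht'.le]

/-- The distance to stationarity does not increase with time. -/
lemma sum_abs_sub_antitone (h : IsReversibleChain P π) {s t : ℕ} (hst : s ≤ t) (x : Ω) :
    ∑ y, |(P ^ t) x y - π y| ≤ ∑ y, |(P ^ s) x y - π y| := by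
  obtain ⟨k, rfl⟩ := Nat.exists_eq_add_of_le hst
  have e : ∀ y, (P ^ (s + k)) x y - π y = ∑ z, ((P ^ s) x z - π z) * (P ^ k) z y := by
    intro y
    rw [pow_add, Matrix.mul_apply]
    simp only [sub_mul, Finset.sum_sub_distrib, (h.pow k).stationary]
  calc _ ≤ ∑ y, ∑ z, |(P ^ s) x z - π z| * (P ^ k) z y := by
        refine Finset.sum_le_sum fun y _ => ?_
        rw [e]
        refine (Finset.abs_sum_le_sum_abs _ _).trans (le_of_eq ?_)
        exact Finset.sum_congr rfl fun z _ => by rw [abs_mul, abs_of_nonneg ((h.pow k).nonneg z y)]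
    _ = _ := by
      rw [Finset.sum_comm]
      simp [← Finset.mul_sum, (h.pow k).row_sum]

end IsReversibleChain

/-- Powers of two row-stochastic matrices with `ℓ¹`-close rows have `ℓ¹`-close rows. -/
lemma sum_abs_pow_sub_pow_le {Ω : Type*} [Fintype Ω] [DecidableEq Ω] {P Q : Matrix Ω Ω ℝ}
    {π ρ : Ω → ℝ} (hP : IsReversibleChain P π) (hQ : IsReversibleChain Q ρ) {δ : ℝ}
    (hδ : ∀ x, ∑ y, |P x y - Q x y| ≤ δ) (t : ℕ) (x : Ω) :
    ∑ y, |(P ^ t) x y - (Q ^ t) x y| ≤ t * δ := by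
  induction t with
  | zero => simp
  | succ t ih =>
    have e : ∀ y, (P ^ (t + 1)) x y - (Q ^ (t + 1)) x y =
        ∑ z, ((P ^ t) x z * (P z y - Q z y) + ((P ^ t) x z - (Q ^ t) x z) * Q z y) := by
      intro y
      rw [pow_succ, pow_succ, Matrix.mul_apply, Matrix.mul_apply, ← Finset.sum_sub_distrib]
      exact Finset.sum_congr rfl fun z _ => by ring
    calc _ ≤ ∑ y, ∑ z, ((P ^ t) x z * |P z y - Q z y| + |(P ^ t) x z - (Q ^ t) x z| * Q z y) := by
          refine Finset.sum_le_sum fun y _ => ?_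
          rw [e]
          refine (Finset.abs_sum_le_sum_abs _ _).trans (Finset.sum_le_sum fun z _ => ?_)
          refine (abs_add_le _ _).trans (le_of_eq ?_)
          rw [abs_mul, abs_mul, abs_of_nonneg ((hP.pow t).nonneg x z),
            abs_of_nonneg (hQ.nonneg z y)]
      _ = ∑ z, ((P ^ t) x z * ∑ y, |P z y - Q z y|) + ∑ z, |(P ^ t) x z - (Q ^ t) x z| := by
        rw [Finset.sum_comm, ← Finset.sum_add_distrib]
        refine Finset.sum_congr rfl fun z _ => ?_
        rw [Finset.sum_add_distrib, ← Finset.mul_sum, ← Finset.mul_sum, hQ.row_sum, mul_one]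
      _ ≤ ∑ z, ((P ^ t) x z * δ) + t * δ := by
        gcongr with z _
        · exact (hP.pow t).nonneg x z
        · exact hδ z
      _ = _ := by
        rw [← Finset.sum_mul, (hP.pow t).row_sum]; push_cast; ring

/-- The heat-bath update along an involution `t`: resample within the orbit `{x, t x}` according
to `π`. -/
noncomputable def heatBath {Ω : Type*} [DecidableEq Ω] (π : Ω → ℝ) (t : Ω → Ω) :
    Matrix Ω Ω ℝ :=
  fun x y => (π x * (if y = x then 1 else 0) + π (t x) * (if y = t x then 1 else 0)) /
    (π x + π (t x))

/-- The chain applying a heat-bath update along a uniformly chosen involution of `S`. -/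
noncomputable def heatBathChain {Ω ι : Type*} [DecidableEq Ω] (S : Finset ι) (π : Ω → ℝ)
    (t : ι → Ω → Ω) : Matrix Ω Ω ℝ :=
  fun x y => (1 / (#S : ℝ)) * ∑ e ∈ S, heatBath π (t e) x y

/-- The conductance `a b / (a + b)` of a heat-bath edge between states of masses `a` and `b`. -/
noncomputable def conductance (a b : ℝ) : ℝ := a * b / (a + b)

lemma conductance_comm (a b : ℝ) : conductance a b = conductance b a := by
  unfold conductance; rw [mul_comm, add_comm]

lemma conductance_nonneg {a b : ℝ} (ha : 0 < a) (hb : 0 < b) : 0 ≤ conductance a b := by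
  unfold conductance; positivity

lemma conductance_le_left {a b : ℝ} (ha : 0 < a) (hb : 0 < b) : conductance a b ≤ a := by
  unfold conductance
  rw [div_le_iff₀ (by positivity)]
  nlinarith [mul_pos ha ha]

lemma le_two_mul_conductance {a b : ℝ} (ha : 0 < a) (hab : a ≤ b) :
    a ≤ 2 * conductance a b := by
  unfold conductance
  rw [mul_div_assoc', le_div_iff₀ (by linarith)]
  nlinarith

lemma conductance_le_mul {a b a' b' q : ℝ} (ha : 0 < a) (hb : 0 < b) (ha' : 0 < a')
    (hb' : 0 < b') (hq : 0 < q) (h1 : a ≤ q * a') (h2 : b ≤ q * b') :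
    conductance a b ≤ q * conductance a' b' := by
  have key : ∀ u v : ℝ, 0 < u → 0 < v → conductance u v = (u⁻¹ + v⁻¹)⁻¹ := by
    intro u v hu hv
    unfold conductance
    field_simp
    rw [add_comm]
  have : q * conductance a' b' = conductance (q * a') (q * b') := by
    unfold conductance; field_simp
  rw [this, key _ _ ha hb, key _ _ (by positivity) (by positivity)]
  gcongr

/-- Total squared gradient of `f` along the involution `t`, weighted by conductance. -/
noncomputable def edgeEnergy {Ω : Type*} [Fintype Ω] (π : Ω → ℝ) (t : Ω → Ω) (f : Ω → ℝ) : ℝ :=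
  ∑ x, conductance (π x) (π (t x)) * (f x - f (t x)) ^ 2

lemma edgeEnergy_nonneg {Ω : Type*} [Fintype Ω] {π : Ω → ℝ} (hpos : ∀ x, 0 < π x) (t : Ω → Ω)
    (f : Ω → ℝ) : 0 ≤ edgeEnergy π t f :=
  Finset.sum_nonneg fun _ _ => mul_nonneg (conductance_nonneg (hpos _) (hpos _)) (sq_nonneg _)

lemma two_mul_sum_eq_of_involutive {Ω : Type*} [Fintype Ω] {t : Ω → Ω} (ht : Function.Involutive t)
    (F : Ω → ℝ) :
    2 * ∑ x, F x = ∑ x, (F x + F (t x)) := by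
  rw [Finset.sum_add_distrib, two_mul]
  congr 1
  exact (Equiv.sum_comp ht.toPerm F).symm

section HeatBath

variable {Ω ι : Type*} [Fintype Ω] [DecidableEq Ω] {π : Ω → ℝ}

lemma heatBath_mulVec (t : Ω → Ω) (f : Ω → ℝ) (x : Ω) :
    ((heatBath π t).mulVec f) x = (π x * f x + π (t x) * f (t x)) / (π x + π (t x)) := by
  simp only [Matrix.mulVec, dotProduct, heatBath, div_mul_eq_mul_div, add_mul, mul_assoc, ite_mul,
    one_mul, zero_mul]
  rw [← Finset.sum_div, Finset.sum_add_distrib, ← Finset.mul_sum, ← Finset.mul_sum]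
  simp

lemma heatBathChain_mulVec (S : Finset ι) (t : ι → Ω → Ω) (f : Ω → ℝ) (x : Ω) :
    ((heatBathChain S π t).mulVec f) x
      = (1 / (#S : ℝ)) * ∑ e ∈ S, ((heatBath π (t e)).mulVec f) x := by
  simp only [Matrix.mulVec, dotProduct, heatBathChain, Finset.mul_sum, Finset.sum_mul]
  rw [Finset.sum_comm]
  simp only [mul_assoc]

lemma heatBath_sq_sum (hpos : ∀ x, 0 < π x) {t : Ω → Ω} (ht : Function.Involutive t)
    (f : Ω → ℝ) : ∑ x, π x * ((heatBath π t).mulVec f) x ^ 2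
      = ∑ x, π x * (f x * ((heatBath π t).mulVec f) x) := by
  rw [← sub_eq_zero, ← Finset.sum_sub_distrib]
  have := two_mul_sum_eq_of_involutive ht fun x =>
    π x * ((heatBath π t).mulVec f) x ^ 2 - π x * (f x * ((heatBath π t).mulVec f) x)
  suffices h : ∀ x, (π x * ((heatBath π t).mulVec f) x ^ 2
      - π x * (f x * ((heatBath π t).mulVec f) x)) + (π (t x) * ((heatBath π t).mulVec f) (t x) ^ 2
      - π (t x) * (f (t x) * ((heatBath π t).mulVec f) (t x))) = 0 by
    simp only [h, Finset.sum_const_zero] at this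
    linarith
  intro x
  have hx := hpos x
  have htx := hpos (t x)
  simp only [heatBath_mulVec, ht x, add_comm (π (t x)) (π x)]
  field_simp
  ring

lemma heatBath_energy (hpos : ∀ x, 0 < π x) {t : Ω → Ω} (ht : Function.Involutive t)
    (f : Ω → ℝ) : chainEnergy (heatBath π t) π f = 1 / 2 * edgeEnergy π t f := by
  unfold chainEnergy
  rw [← Finset.sum_sub_distrib]
  have := two_mul_sum_eq_of_involutive ht fun x =>
    π x * f x ^ 2 - π x * (f x * ((heatBath π t).mulVec f) x)
  suffices h : ∀ x, (π x * f x ^ 2 - π x * (f x * ((heatBath π t).mulVec f) x))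
      + (π (t x) * f (t x) ^ 2 - π (t x) * (f (t x) * ((heatBath π t).mulVec f) (t x)))
      = conductance (π x) (π (t x)) * (f x - f (t x)) ^ 2 by
    simp only [h] at this
    unfold edgeEnergy
    linarith
  intro x
  have hx := hpos x
  have htx := hpos (t x)
  simp only [heatBath_mulVec, ht x, conductance, add_comm (π (t x)) (π x)]
  field_simp
  ring

lemma heatBath_row_sum (hpos : ∀ x, 0 < π x) (t : Ω → Ω) (x : Ω) :
    ∑ y, heatBath π t x y = 1 := by
  have := heatBath_mulVec (π := π) t (fun _ => 1) x
  simp only [Matrix.mulVec, dotProduct, mul_one] at this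
  rw [this, div_self (add_pos (hpos _) (hpos _)).ne']

lemma heatBathChain_isReversibleChain (hpos : ∀ x, 0 < π x) (hsum : ∑ x, π x = 1)
    {S : Finset ι} (hS : S.Nonempty) {t : ι → Ω → Ω} (ht : ∀ e, Function.Involutive (t e)) :
    IsReversibleChain (heatBathChain S π t) π where
  nonneg x y := by
    refine mul_nonneg (by positivity) (Finset.sum_nonneg fun e _ => ?_)
    have h1 := hpos x
    have h2 := hpos (t e x)
    unfold heatBath
    split_ifs <;> positivity
  row_sum x := by
    have hc : (#S : ℝ) ≠ 0 := by exact_mod_cast hS.card_pos.ne'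
    simp only [heatBathChain]
    rw [← Finset.mul_sum, Finset.sum_comm]
    simp [heatBath_row_sum hpos, hc]
  reversible x y := by
    simp only [heatBathChain, mul_left_comm (π _), Finset.mul_sum]
    refine Finset.sum_congr rfl fun e _ => ?_
    congr 1
    unfold heatBath
    have h1 := hpos x
    have h2 := hpos y
    by_cases hxy : y = x
    · subst hxy; rfl
    by_cases h : y = t e x
    · have h' : x = t e y := by rw [h, ht]
      have h'' : ¬ t e y = y := by rw [← h']; exact Ne.symm hxy
      rw [← h, if_neg hxy, if_pos rfl, if_neg (Ne.symm hxy), if_pos h', ← h', add_comm (π y)]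
      ring
    · have h' : ¬ x = t e y := fun h' => h (by rw [h', ht])
      simp [hxy, h, Ne.symm hxy, h']
  pos := hpos
  sum_eq_one := hsum

lemma heatBathChain_psd (hpos : ∀ x, 0 < π x) {S : Finset ι} (hS : S.Nonempty)
    {t : ι → Ω → Ω} (ht : ∀ e, Function.Involutive (t e)) (f : Ω → ℝ) :
    ∑ x, π x * ((heatBathChain S π t).mulVec f) x ^ 2
      ≤ ∑ x, π x * (f x * ((heatBathChain S π t).mulVec f) x) := by
  have hc : (0 : ℝ) < #S := by exact_mod_cast hS.card_pos
  calc _ ≤ ∑ x, π x * ((1 / (#S : ℝ)) * ∑ e ∈ S, ((heatBath π (t e)).mulVec f) x ^ 2) := by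
        refine Finset.sum_le_sum fun x _ => mul_le_mul_of_nonneg_left ?_ (hpos x).le
        rw [heatBathChain_mulVec, mul_pow]
        calc _ ≤ (1 / (#S : ℝ)) ^ 2 * (#S * ∑ e ∈ S, ((heatBath π (t e)).mulVec f) x ^ 2) := by
              gcongr; exact sq_sum_le_card_mul_sum_sq
          _ = _ := by field_simp
    _ = (1 / (#S : ℝ)) * ∑ e ∈ S, ∑ x, π x * ((heatBath π (t e)).mulVec f) x ^ 2 := by
        rw [Finset.sum_comm]
        simp only [Finset.mul_sum, mul_left_comm (π _)]
    _ = (1 / (#S : ℝ)) * ∑ e ∈ S, ∑ x, π x * (f x * ((heatBath π (t e)).mulVec f) x) := by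
        simp only [heatBath_sq_sum hpos (ht _)]
    _ = _ := by
        rw [Finset.sum_comm]
        simp only [heatBathChain_mulVec, Finset.mul_sum]
        exact Finset.sum_congr rfl fun x _ => Finset.sum_congr rfl fun e _ => by ring

lemma heatBathChain_energy (hpos : ∀ x, 0 < π x) {S : Finset ι} (hS : S.Nonempty)
    {t : ι → Ω → Ω} (ht : ∀ e, Function.Involutive (t e)) (f : Ω → ℝ) :
    chainEnergy (heatBathChain S π t) π f = 1 / (2 * #S) * ∑ e ∈ S, edgeEnergy π (t e) f := by
  have hc : (0 : ℝ) < #S := by exact_mod_cast hS.card_pos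
  have h1 : chainEnergy (heatBathChain S π t) π f
      = (1 / (#S : ℝ)) * ∑ e ∈ S, chainEnergy (heatBath π (t e)) π f := by
    simp only [chainEnergy, Finset.sum_sub_distrib, Finset.sum_const, nsmul_eq_mul, mul_sub]
    congr 1
    · field_simp
    · rw [Finset.sum_comm]
      simp only [heatBathChain_mulVec, Finset.mul_sum]
      exact Finset.sum_congr rfl fun x _ => Finset.sum_congr rfl fun e _ => by ring
  rw [h1]
  simp only [heatBath_energy hpos (ht _), ← Finset.mul_sum]
  field_simp

end HeatBath

/-- Positions `i < j` carry labels of the interval `[lo, hi]`, with no such label in between. -/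
structure IsConsecutive {n : ℕ} (lo hi : ℕ) (σ : Equiv.Perm (Fin n)) (i j : Fin n) : Prop where
  lt : i < j
  left : lo ≤ (σ i : ℕ) ∧ (σ i : ℕ) ≤ hi
  right : lo ≤ (σ j : ℕ) ∧ (σ j : ℕ) ≤ hi
  between : ∀ l, i < l → l < j → ¬(lo ≤ (σ l : ℕ) ∧ (σ l : ℕ) ≤ hi)

/-- The adjacent positions `a, b` swapped by one step of the reduction bringing the consecutive
positions `i < j` together: the leftmost label below `lo` in the gap moves to the left, and if the
gap has no such label, then the label at `j` moves to the left. -/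
structure IsReductionStep {n : ℕ} (lo : ℕ) (σ : Equiv.Perm (Fin n)) (i j a b : Fin n) :
    Prop where
  succ : (a : ℕ) + 1 = b
  le_left : i ≤ a
  le_right : b ≤ j
  first : ∀ l, i < l → l < b → ¬((σ l : ℕ) < lo)
  small : b ≠ j → (σ b : ℕ) < lo
  not_both : ¬(a = i ∧ b = j)

section Reduction

variable {n lo hi : ℕ} {σ : Equiv.Perm (Fin n)} {i j a b : Fin n}

lemma IsConsecutive.exists_reductionStep (h : IsConsecutive lo hi σ i j)
    (hij : (i : ℕ) + 1 ≠ j) : ∃ a b, IsReductionStep lo σ i j a b := by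
  classical
  have hlt : (i : ℕ) < j := h.lt
  by_cases hS : ∃ l, i < l ∧ l < j ∧ (σ l : ℕ) < lo
  · let S : Finset (Fin n) := univ.filter fun l => i < l ∧ l < j ∧ (σ l : ℕ) < lo
    have hSne : S.Nonempty := by
      obtain ⟨l, hl⟩ := hS
      exact ⟨l, by simpa [S] using hl⟩
    obtain ⟨b, hbS, hb⟩ := S.exists_min_image (fun l => l) hSne
    simp only [S, mem_filter, mem_univ, true_and] at hbS hb
    have hib : (i : ℕ) < b := hbS.1
    have hbj : (b : ℕ) < j := hbS.2.1
    refine ⟨⟨b - 1, by omega⟩, b, ?_, ?_, hbS.2.1.le, ?_, fun _ => hbS.2.2, ?_⟩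
    · simp only; omega
    · rw [Fin.le_def]; simp only; omega
    · intro l hl hlb hlo
      exact absurd (hb l ⟨hl, hlb.trans hbS.2.1, hlo⟩) (not_le.2 hlb)
    · rintro ⟨-, rfl⟩; exact lt_irrefl _ hbj
  · push Not at hS
    refine ⟨⟨j - 1, by omega⟩, j, ?_, ?_, le_rfl, fun l h1 h2 => not_lt.2 (hS l h1 h2),
      fun h => absurd rfl h, ?_⟩
    · simp only; omega
    · rw [Fin.le_def]; simp only; omega
    · rintro ⟨h1, -⟩
      rw [Fin.ext_iff] at h1; simp only at h1; omega

lemma IsReductionStep.lt (h : IsReductionStep lo σ i j a b) : a < b := by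
  have := h.succ; rw [Fin.lt_def]; omega

lemma IsReductionStep.descent (h : IsReductionStep lo σ i j a b)
    (hc : IsConsecutive lo hi σ i j) : (σ b : ℕ) < σ a := by
  have hab := h.lt
  rcases eq_or_ne b j with rfl | hbj
  · have hai : i < a := lt_of_le_of_ne h.le_left fun e => h.not_both ⟨e.symm, rfl⟩
    have h1 := h.first a hai hab
    have h2 := hc.between a hai hab
    have h3 := hc.right
    omega
  · have h0 := h.small hbj
    rcases h.le_left.eq_or_lt with rfl | hai
    · have := hc.left; omega
    · have h1 := h.first a hai hab
      omega

lemma IsConsecutive.swap (hc : IsConsecutive lo hi σ i j) :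
    IsConsecutive lo hi (σ * Equiv.swap i j) i j where
  lt := hc.lt
  left := by simpa using hc.right
  right := by simpa using hc.left
  between l h1 h2 := by
    simpa [Equiv.swap_apply_of_ne_of_ne h1.ne' h2.ne] using hc.between l h1 h2

lemma IsReductionStep.swap (h : IsReductionStep lo σ i j a b) :
    IsReductionStep lo (σ * Equiv.swap i j) i j a b where
  succ := h.succ
  le_left := h.le_left
  le_right := h.le_right
  first l h1 h2 := by
    simpa [Equiv.swap_apply_of_ne_of_ne h1.ne' (h2.trans_le h.le_right).ne] using h.first l h1 h2
  small hbj := by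
    simpa [Equiv.swap_apply_of_ne_of_ne (h.le_left.trans_lt h.lt).ne' hbj] using h.small hbj
  not_both := h.not_both

lemma IsReductionStep.swap_apply_left (h : IsReductionStep lo σ i j a b) :
    Equiv.swap a b (if a = i then b else i) = i := by
  split_ifs with hai
  · simp [hai]
  · exact Equiv.swap_apply_of_ne_of_ne (Ne.symm hai) (h.le_left.trans_lt h.lt).ne

lemma IsReductionStep.swap_apply_right (h : IsReductionStep lo σ i j a b) :
    Equiv.swap a b (if b = j then a else j) = j := by
  split_ifs with hbj
  · simp [hbj]
  · exact Equiv.swap_apply_of_ne_of_ne (h.lt.trans_le h.le_right).ne' (Ne.symm hbj)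

lemma IsReductionStep.mul_swap (h : IsReductionStep lo σ i j a b) :
    σ * Equiv.swap a b * Equiv.swap (if a = i then b else i) (if b = j then a else j)
      = σ * Equiv.swap i j * Equiv.swap a b := by
  conv_rhs => rw [← h.swap_apply_left, ← h.swap_apply_right, Equiv.swap_apply_apply]
  simp [mul_assoc]

lemma IsReductionStep.isConsecutive (h : IsReductionStep lo σ i j a b)
    (hc : IsConsecutive lo hi σ i j) :
    IsConsecutive lo hi (σ * Equiv.swap a b) (if a = i then b else i)
      (if b = j then a else j) where
  lt := by
    have h1 := h.le_left
    have h2 := h.le_right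
    have h3 := h.not_both
    have h4 := h.lt
    have h5 := hc.lt
    split_ifs with h6 h7 h7
    · exact absurd ⟨h6, h7⟩ h3
    · exact lt_of_le_of_ne h2 h7
    · exact lt_of_le_of_ne h1 (Ne.symm h6)
    · exact h5
  left := by rw [Equiv.Perm.mul_apply, h.swap_apply_left]; exact hc.left
  right := by rw [Equiv.Perm.mul_apply, h.swap_apply_right]; exact hc.right
  between l hl1 hl2 := by
    rw [Equiv.Perm.mul_apply]
    have h1 := h.le_left
    have h2 := h.le_right
    have h4 := h.lt
    rcases eq_or_ne l a with rfl | hla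
    · rw [Equiv.swap_apply_left]
      refine hc.between b (h1.trans_lt h4) (lt_of_le_of_ne h2 fun e => ?_)
      rw [if_pos e] at hl2
      exact lt_irrefl _ hl2
    rcases eq_or_ne l b with rfl | hlb
    · rw [Equiv.swap_apply_right]
      refine hc.between a (lt_of_le_of_ne h1 fun e => ?_) (h4.trans_le h2)
      rw [if_pos e.symm] at hl1
      exact lt_irrefl _ hl1
    rw [Equiv.swap_apply_of_ne_of_ne hla hlb]
    refine hc.between l (lt_of_le_of_lt ?_ hl1) (lt_of_lt_of_le hl2 ?_)
    · split_ifs with e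
      · rw [← e]; exact h4.le
      · exact le_rfl
    · split_ifs with e
      · rw [← e]; exact h4.le
      · exact le_rfl

/-- A pair of positions is inside at most one gap between consecutive labels of `[lo, hi]`. -/
lemma IsConsecutive.eq_of_mem_gap {i₂ j₂ : Fin n} (h₁ : IsConsecutive lo hi σ i j)
    (h₂ : IsConsecutive lo hi σ i₂ j₂) (hab : a < b) (hi₁ : i ≤ a) (hj₁ : b ≤ j) (hi₂ : i₂ ≤ a)
    (hj₂ : b ≤ j₂) : i = i₂ ∧ j = j₂ := by
  constructor
  · rcases lt_trichotomy i i₂ with h | h | h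
    · exact absurd h₂.left (h₁.between _ h (hi₂.trans_lt (hab.trans_le hj₁)))
    · exact h
    · exact absurd h₁.left (h₂.between _ h (hi₁.trans_lt (hab.trans_le hj₂)))
  · rcases lt_trichotomy j j₂ with h | h | h
    · exact absurd h₁.right (h₂.between _ (hi₂.trans_lt (hab.trans_le hj₁)) h)
    · exact h
    · exact absurd h₂.right (h₁.between _ (hi₁.trans_lt (hab.trans_le hj₂)) h)

/-- Reduction steps moving the label at `i` are injective. -/
lemma IsReductionStep.injective_of_eq {σ₂ : Equiv.Perm (Fin n)} {i₂ j₂ a₂ b₂ : Fin n}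
    (h₁ : IsReductionStep lo σ i j a b) (h₂ : IsReductionStep lo σ₂ i₂ j₂ a₂ b₂) (e₁ : a = i)
    (e₂ : a₂ = i₂) (hσ : σ * Equiv.swap a b = σ₂ * Equiv.swap a₂ b₂)
    (hl : (if a = i then b else i) = if a₂ = i₂ then b₂ else i₂)
    (hr : (if b = j then a else j) = if b₂ = j₂ then a₂ else j₂) :
    σ = σ₂ ∧ i = i₂ ∧ j = j₂ := by
  rw [if_pos e₁, if_pos e₂] at hl
  rw [if_neg fun e => h₁.not_both ⟨e₁, e⟩, if_neg fun e => h₂.not_both ⟨e₂, e⟩] at hr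
  have s₁ := h₁.succ
  have s₂ := h₂.succ
  subst hl
  have ha : a = a₂ := Fin.ext (by omega)
  subst ha
  exact ⟨mul_right_cancel hσ, by rw [← e₁, ← e₂], hr⟩

/-- Reduction steps not moving the label at `i` are injective. -/
lemma IsReductionStep.injective_of_ne {σ₂ : Equiv.Perm (Fin n)} {i₂ j₂ a₂ b₂ : Fin n}
    (h₁ : IsReductionStep lo σ i j a b) (h₂ : IsReductionStep lo σ₂ i₂ j₂ a₂ b₂) (e₁ : a ≠ i)
    (e₂ : a₂ ≠ i₂) (hσ : σ * Equiv.swap a b = σ₂ * Equiv.swap a₂ b₂)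
    (hl : (if a = i then b else i) = if a₂ = i₂ then b₂ else i₂)
    (hr : (if b = j then a else j) = if b₂ = j₂ then a₂ else j₂) :
    σ = σ₂ ∧ i = i₂ ∧ j = j₂ := by
  rw [if_neg e₁, if_neg e₂] at hl
  subst hl
  have s₁ := h₁.succ
  have s₂ := h₂.succ
  have small : ∀ {σ : Equiv.Perm (Fin n)} {j a b : Fin n}, IsReductionStep lo σ i j a b →
      b ≠ j → ((σ * Equiv.swap a b) a : ℕ) < lo := by
    intro σ j a b h hb
    simpa using h.small hb
  have first : ∀ {σ : Equiv.Perm (Fin n)} {j a b : Fin n}, IsReductionStep lo σ i j a b →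
      ∀ l, i < l → l < a → ¬ ((σ * Equiv.swap a b) l : ℕ) < lo := by
    intro σ j a b h l hl hla
    rw [Equiv.Perm.mul_apply, Equiv.swap_apply_of_ne_of_ne hla.ne (hla.trans h.lt).ne]
    exact h.first l hl (hla.trans h.lt)
  have hia₁ : i < a := lt_of_le_of_ne h₁.le_left (Ne.symm e₁)
  have hia₂ : i < a₂ := lt_of_le_of_ne h₂.le_left (Ne.symm e₂)
  have key : a = a₂ ∧ j = j₂ := by
    by_cases b₁ : b = j <;> by_cases b₂ : b₂ = j₂
    · rw [if_pos b₁, if_pos b₂] at hr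
      refine ⟨hr, ?_⟩
      rw [← b₁, ← b₂]; subst hr; exact Fin.ext (by omega)
    · rw [if_pos b₁, if_neg b₂] at hr
      have h := first h₁ a₂ hia₂ (by rw [hr]; exact h₂.lt.trans_le h₂.le_right)
      rw [hσ] at h
      exact absurd (small h₂ b₂) h
    · rw [if_neg b₁, if_pos b₂] at hr
      have h := first h₂ a hia₁ (by rw [← hr]; exact h₁.lt.trans_le h₁.le_right)
      rw [← hσ] at h
      exact absurd (small h₁ b₁) h
    · rw [if_neg b₁, if_neg b₂] at hr
      refine ⟨?_, hr⟩
      rcases lt_trichotomy a a₂ with h | h | h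
      · have := first h₂ a hia₁ h
        rw [← hσ] at this
        exact absurd (small h₁ b₁) this
      · exact h
      · have := first h₁ a₂ hia₂ h
        rw [hσ] at this
        exact absurd (small h₂ b₂) this
  obtain ⟨rfl, rfl⟩ := key
  have hb : b = b₂ := Fin.ext (by omega)
  subst hb
  exact ⟨mul_right_cancel hσ, rfl, rfl⟩

end Reduction

/-- Pairs of neighbouring positions. -/
def adjacentPairs (n : ℕ) : Finset (Fin n × Fin n) := univ.filter fun e => (e.2 : ℕ) = e.1 + 1

/-- Contribution to the Dirichlet form of swapping the labels at a pair of positions. -/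
noncomputable def swapEnergy {n : ℕ} (π f : Equiv.Perm (Fin n) → ℝ)
    (x : Equiv.Perm (Fin n) × (Fin n × Fin n)) : ℝ :=
  conductance (π x.1) (π (x.1 * Equiv.swap x.2.1 x.2.2)) *
    (f x.1 - f (x.1 * Equiv.swap x.2.1 x.2.2)) ^ 2

/-- Dirichlet form (up to normalization) of the adjacent swaps. -/
noncomputable def adjacentEnergy {n : ℕ} (π f : Equiv.Perm (Fin n) → ℝ) : ℝ :=
  ∑ x ∈ univ ×ˢ adjacentPairs n, swapEnergy π f x

/-- The constant of the comparison between consecutive swaps and adjacent swaps. -/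
noncomputable def comparisonConst (q : ℝ) : ℝ :=
  (1 + 8 * (1 + 4 * q / (1 - 2 * q))) * 2 / (1 - 2 * q)

lemma comparisonConst_pos {q : ℝ} (hq0 : 0 < q) (hq : q < 1 / 2) : 0 < comparisonConst q := by
  unfold comparisonConst
  have : 0 < 1 - 2 * q := by linarith
  positivity

section Comparison

variable {n : ℕ} {q : ℝ} {π : Equiv.Perm (Fin n) → ℝ}

lemma swapEnergy_nonneg (hpos : ∀ σ, 0 < π σ) (f : Equiv.Perm (Fin n) → ℝ)
    (x : Equiv.Perm (Fin n) × (Fin n × Fin n)) : 0 ≤ swapEnergy π f x :=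
  mul_nonneg (conductance_nonneg (hpos _) (hpos _)) (sq_nonneg _)

open Classical in
lemma sum_swapEnergy_le_of_injOn {α : Type*} (hpos : ∀ σ, 0 < π σ)
    (f : Equiv.Perm (Fin n) → ℝ) (s : Finset α)
    (t : Finset (Equiv.Perm (Fin n) × (Fin n × Fin n)))
    (φ : α → Equiv.Perm (Fin n) × (Fin n × Fin n)) (hφ : ∀ x ∈ s, φ x ∈ t)
    (hinj : Set.InjOn φ s) :
    ∑ x ∈ s, swapEnergy π f (φ x) ≤ ∑ y ∈ t, swapEnergy π f y := by
  rw [← Finset.sum_image (f := swapEnergy π f) hinj]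
  refine Finset.sum_le_sum_of_subset_of_nonneg ?_ fun _ _ _ => swapEnergy_nonneg hpos f _
  intro y hy
  obtain ⟨x, hx, rfl⟩ := Finset.mem_image.1 hy
  exact hφ x hx

open Classical in
/-- Swaps of consecutive labels of an interval are controlled by adjacent swaps, when each
adjacent descent can be sorted at the price of a factor `q < 1 / 2`. -/
theorem sum_consecutive_le (hq0 : 0 < q) (hq : q < 1 / 2) (hpos : ∀ σ, 0 < π σ)
    (hgain : ∀ (σ : Equiv.Perm (Fin n)) (a b : Fin n), (a : ℕ) + 1 = b → (σ b : ℕ) < σ a →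
      π σ ≤ q * π (σ * Equiv.swap a b)) (f : Equiv.Perm (Fin n) → ℝ) (lo hi : ℕ) :
    ∑ x ∈ univ.filter (fun x : Equiv.Perm (Fin n) × (Fin n × Fin n) =>
      IsConsecutive lo hi x.1 x.2.1 x.2.2), swapEnergy π f x
      ≤ comparisonConst q * adjacentEnergy π f := by
  set X := univ.filter (fun x : Equiv.Perm (Fin n) × (Fin n × Fin n) =>
      IsConsecutive lo hi x.1 x.2.1 x.2.2) with hX
  set N := ∑ x ∈ X, swapEnergy π f x with hN
  set D := adjacentEnergy π f with hD
  have hD0 : 0 ≤ D := Finset.sum_nonneg fun _ _ => swapEnergy_nonneg hpos f _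
  set Y := X.filter fun x => ¬((x.2.1 : ℕ) + 1 = x.2.2) with hY
  have hYc : ∀ x ∈ Y, IsConsecutive lo hi x.1 x.2.1 x.2.2 := by
    intro x hx
    simp only [hY, hX, mem_filter, mem_univ, true_and] at hx
    exact hx.1
  have hstep : ∀ x : Equiv.Perm (Fin n) × (Fin n × Fin n), ∃ e : Fin n × Fin n,
      x ∈ Y → IsReductionStep lo x.1 x.2.1 x.2.2 e.1 e.2 := by
    intro x
    by_cases hx : x ∈ Y
    · obtain ⟨a, b, h⟩ := (hYc x hx).exists_reductionStep (by simp [hY] at hx; exact hx.2)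
      exact ⟨(a, b), fun _ => h⟩
    · exact ⟨x.2, fun h => absurd h hx⟩
  choose e he using hstep
  set T : Equiv.Perm (Fin n) × (Fin n × Fin n) → Equiv.Perm (Fin n) × (Fin n × Fin n) :=
    fun x => (x.1 * Equiv.swap (e x).1 (e x).2,
      (if (e x).1 = x.2.1 then (e x).2 else x.2.1),
      (if (e x).2 = x.2.2 then (e x).1 else x.2.2)) with hT
  have hTX : ∀ x ∈ Y, T x ∈ X := by
    intro x hx
    simp only [hX, mem_filter, mem_univ, true_and, hT]
    exact (he x hx).isConsecutive (hYc x hx)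
  set U : Equiv.Perm (Fin n) × (Fin n × Fin n) → Equiv.Perm (Fin n) × (Fin n × Fin n) :=
    fun x => (x.1, e x) with hU
  set V : Equiv.Perm (Fin n) × (Fin n × Fin n) → Equiv.Perm (Fin n) × (Fin n × Fin n) :=
    fun x => (x.1 * Equiv.swap x.2.1 x.2.2, e x) with hV
  have hadj : ∀ x ∈ Y, e x ∈ adjacentPairs n := by
    intro x hx
    simp only [adjacentPairs, mem_filter, mem_univ, true_and]
    exact (he x hx).succ.symm
  have hUD : ∑ x ∈ Y, swapEnergy π f (U x) ≤ D := by
    refine sum_swapEnergy_le_of_injOn hpos f Y _ U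
      (fun x hx => by simpa [hU] using hadj x hx) ?_
    intro x hx y hy hxy
    simp only [hU, Prod.mk.injEq] at hxy
    have hx' := he x hx
    have hy' := he y hy
    have cx := hYc x hx
    have cy := hYc y hy
    rw [← hxy.1, ← hxy.2] at hy'
    rw [← hxy.1] at cy
    have := cx.eq_of_mem_gap cy hx'.lt hx'.le_left hx'.le_right hy'.le_left hy'.le_right
    exact Prod.ext hxy.1 (Prod.ext this.1 this.2)
  have hVD : ∑ x ∈ Y, swapEnergy π f (V x) ≤ D := by
    refine sum_swapEnergy_le_of_injOn hpos f Y _ V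
      (fun x hx => by simpa [hV] using hadj x hx) ?_
    intro x hx y hy hxy
    simp only [hV, Prod.mk.injEq] at hxy
    have hx' := he x hx
    have hy' := he y hy
    have cx := (hYc x hx).swap
    have cy := (hYc y hy).swap
    rw [← hxy.2] at hy'
    rw [← hxy.1] at cy
    have := cx.eq_of_mem_gap cy hx'.lt hx'.le_left hx'.le_right hy'.le_left hy'.le_right
    have h1 := hxy.1
    rw [this.1, this.2] at h1
    exact Prod.ext (mul_right_cancel h1) (Prod.ext this.1 this.2)
  have hTN : ∑ x ∈ Y, swapEnergy π f (T x) ≤ 2 * N := by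
    rw [← Finset.sum_filter_add_sum_filter_not Y (fun x => (e x).1 = x.2.1), two_mul]
    refine add_le_add (sum_swapEnergy_le_of_injOn hpos f _ X T
      (fun x hx => hTX x (mem_filter.1 hx).1) ?_) (sum_swapEnergy_le_of_injOn hpos f _ X T
      (fun x hx => hTX x (mem_filter.1 hx).1) ?_)
    · intro x hx y hy hxy
      have hx' := mem_filter.1 (Finset.mem_coe.1 hx)
      have hy' := mem_filter.1 (Finset.mem_coe.1 hy)
      simp only [hT, Prod.mk.injEq] at hxy
      have := (he x hx'.1).injective_of_eq (he y hy'.1) hx'.2 hy'.2 hxy.1 hxy.2.1 hxy.2.2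
      exact Prod.ext this.1 (Prod.ext this.2.1 this.2.2)
    · intro x hx y hy hxy
      have hx' := mem_filter.1 (Finset.mem_coe.1 hx)
      have hy' := mem_filter.1 (Finset.mem_coe.1 hy)
      simp only [hT, Prod.mk.injEq] at hxy
      have := (he x hx'.1).injective_of_ne (he y hy'.1) hx'.2 hy'.2 hxy.1 hxy.2.1 hxy.2.2
      exact Prod.ext this.1 (Prod.ext this.2.1 this.2.2)
  have hadjD : ∑ x ∈ X.filter (fun x => (x.2.1 : ℕ) + 1 = x.2.2), swapEnergy π f x ≤ D := by
    refine sum_swapEnergy_le_of_injOn hpos f _ _ id (fun x hx => ?_) Function.injective_id.injOn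
    simp only [mem_filter] at hx
    simp [adjacentPairs, hx.2]
  have h1q : 0 < 1 - 2 * q := by linarith
  set ε := (1 - 2 * q) / (4 * q) with hε
  have hε0 : 0 < ε := by positivity
  have hpoint : ∀ x ∈ Y, swapEnergy π f x ≤ (1 + ε) * q * swapEnergy π f (T x)
      + 4 * (1 + 1 / ε) * (swapEnergy π f (U x) + swapEnergy π f (V x)) := by
    intro x hx
    have hs := he x hx
    have hc := hYc x hx
    have hmul : (T x).1 * Equiv.swap (T x).2.1 (T x).2.2
        = x.1 * Equiv.swap x.2.1 x.2.2 * Equiv.swap (e x).1 (e x).2 := hs.mul_swap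
    have g1 := hgain _ _ _ hs.succ (hs.descent hc)
    have g2 := hgain _ _ _ hs.succ (hs.swap.descent hc.swap)
    simp only [swapEnergy, hmul]
    simp only [hU, hV, hT]
    set A := f x.1
    set A' := f (x.1 * Equiv.swap (e x).1 (e x).2)
    set B := f (x.1 * Equiv.swap x.2.1 x.2.2)
    set B' := f (x.1 * Equiv.swap x.2.1 x.2.2 * Equiv.swap (e x).1 (e x).2)
    have p1 := hpos x.1
    have p2 := hpos (x.1 * Equiv.swap (e x).1 (e x).2)
    have p3 := hpos (x.1 * Equiv.swap x.2.1 x.2.2)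
    have p4 := hpos (x.1 * Equiv.swap x.2.1 x.2.2 * Equiv.swap (e x).1 (e x).2)
    set a := π x.1
    set a' := π (x.1 * Equiv.swap (e x).1 (e x).2)
    set b := π (x.1 * Equiv.swap x.2.1 x.2.2)
    set b' := π (x.1 * Equiv.swap x.2.1 x.2.2 * Equiv.swap (e x).1 (e x).2)
    have c1 : conductance a b ≤ q * conductance a' b' :=
      conductance_le_mul p1 p3 p2 p4 hq0 g1 g2
    have c2 : conductance a b ≤ 2 * conductance a a' :=
      (conductance_le_left p1 p3).trans (le_two_mul_conductance p1 (by nlinarith))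
    have c3 : conductance a b ≤ 2 * conductance b b' := by
      rw [conductance_comm]
      exact (conductance_le_left p3 p1).trans (le_two_mul_conductance p3 (by nlinarith))
    have c0 := conductance_nonneg p1 p3
    have hsq : (A - B) ^ 2 ≤ (1 + ε) * (A' - B') ^ 2
        + 2 * (1 + 1 / ε) * ((A - A') ^ 2 + (B - B') ^ 2) := by
      set u := A' - B'
      set v := (A - A') - (B - B')
      have e1 : A - B = u + v := by simp only [u, v]; ring
      have h1 : (u + v) ^ 2 ≤ (1 + ε) * u ^ 2 + (1 + 1 / ε) * v ^ 2 := by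
        have : (1 + ε) * u ^ 2 + (1 + 1 / ε) * v ^ 2 - (u + v) ^ 2 = (ε * u - v) ^ 2 / ε := by
          field_simp; ring
        have h2 : 0 ≤ (ε * u - v) ^ 2 / ε := by positivity
        linarith
      have h2 : v ^ 2 ≤ 2 * ((A - A') ^ 2 + (B - B') ^ 2) := by
        nlinarith [sq_nonneg ((A - A') + (B - B'))]
      rw [e1]
      calc _ ≤ _ := h1
        _ ≤ (1 + ε) * u ^ 2 + (1 + 1 / ε) * (2 * ((A - A') ^ 2 + (B - B') ^ 2)) := by gcongr
        _ = _ := by ring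
    calc conductance a b * (A - B) ^ 2
        ≤ conductance a b * ((1 + ε) * (A' - B') ^ 2
        + 2 * (1 + 1 / ε) * ((A - A') ^ 2 + (B - B') ^ 2)) := by gcongr
      _ = (1 + ε) * (conductance a b * (A' - B') ^ 2)
        + 2 * (1 + 1 / ε) * (conductance a b * (A - A') ^ 2
          + conductance a b * (B - B') ^ 2) := by ring
      _ ≤ (1 + ε) * (q * conductance a' b' * (A' - B') ^ 2)
        + 2 * (1 + 1 / ε) * (2 * conductance a a' * (A - A') ^ 2
          + 2 * conductance b b' * (B - B') ^ 2) := by gcongr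
      _ = _ := by ring
  have hsum : N ≤ D + ((1 + ε) * q * (2 * N) + 4 * (1 + 1 / ε) * (D + D)) := by
    calc N = ∑ x ∈ X.filter (fun x => (x.2.1 : ℕ) + 1 = x.2.2), swapEnergy π f x
          + ∑ x ∈ Y, swapEnergy π f x := (Finset.sum_filter_add_sum_filter_not X _ _).symm
      _ ≤ D + ∑ x ∈ Y, ((1 + ε) * q * swapEnergy π f (T x)
          + 4 * (1 + 1 / ε) * (swapEnergy π f (U x) + swapEnergy π f (V x))) := by
        gcongr with x hx
        exact hpoint x hx
      _ = D + ((1 + ε) * q * ∑ x ∈ Y, swapEnergy π f (T x) + 4 * (1 + 1 / ε) *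
          (∑ x ∈ Y, swapEnergy π f (U x) + ∑ x ∈ Y, swapEnergy π f (V x))) := by
        rw [Finset.sum_add_distrib, ← Finset.mul_sum, ← Finset.mul_sum, Finset.sum_add_distrib]
      _ ≤ _ := by gcongr
  have e1 : (1 + ε) * q * (2 * N) = (1 + 2 * q) / 2 * N := by
    rw [hε]; field_simp; ring
  have e2 : 1 / ε = 4 * q / (1 - 2 * q) := by rw [hε]; field_simp
  rw [e1, e2] at hsum
  unfold comparisonConst
  rw [div_mul_eq_mul_div, le_div_iff₀ h1q]
  linarith

end Comparison

/-- Swap probabilities `p u v` for labels `u < v < n` and intervals `I u v` of labels, such that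
`u < v` are swapped at the price of at most `q`, labels outside `I u v` see `u` and `v` in
the same way, and there are few intervals. -/
structure IsLeague (n : ℕ) (q : ℝ) (p : ℕ → ℕ → ℝ) (I : ℕ → ℕ → ℕ × ℕ) : Prop where
  pos : ∀ u v, u < v → v < n → 0 < p u v
  lt_one : ∀ u v, u < v → v < n → p u v < 1
  ratio : ∀ u v, u < v → v < n → 1 - p u v ≤ q * p u v
  le_left : ∀ u v, u < v → v < n → (I u v).1 ≤ u
  le_right : ∀ u v, u < v → v < n → v ≤ (I u v).2
  below : ∀ u v w, u < v → v < n → w < (I u v).1 → p w u = p w v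
  above : ∀ u v w, u < v → v < n → w < n → (I u v).2 < w → p u w = p v w
  exists_succ : ∀ u v, u < v → v < n → ∃ k < n, I u v = I k (k + 1)

section Weight

variable {n : ℕ}

/-- The product of the odds of the inversions of a permutation. -/
noncomputable def inversionWeight (p : ℕ → ℕ → ℝ) (σ : Equiv.Perm (Fin n)) : ℝ :=
  ∏ u : Fin n, ∏ v : Fin n,
    if u < v ∧ σ.symm v < σ.symm u then (1 - p (u : ℕ) (v : ℕ)) / p (u : ℕ) (v : ℕ) else 1

/-- The probability distribution proportional to `inversionWeight`. -/
noncomputable def inversionPi (p : ℕ → ℕ → ℝ) (σ : Equiv.Perm (Fin n)) : ℝ :=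
  inversionWeight p σ / ∑ τ : Equiv.Perm (Fin n), inversionWeight p τ

/-- The weight of an ordered pair of labels. -/
noncomputable def pairWeight (p : ℕ → ℕ → ℝ) (u v : ℕ) : ℝ :=
  if v < u then (1 - p v u) / p v u else 1

/-- No label between the positions `i` and `j` lies in the interval of the labels at `i`, `j`. -/
def Unblocked (I : ℕ → ℕ → ℕ × ℕ) (σ : Equiv.Perm (Fin n)) (i j : Fin n) : Prop :=
  ∀ l, i < l → l < j →
    ¬((I (min (σ i : ℕ) (σ j : ℕ)) (max (σ i : ℕ) (σ j : ℕ))).1 ≤ (σ l : ℕ) ∧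
      (σ l : ℕ) ≤ (I (min (σ i : ℕ) (σ j : ℕ)) (max (σ i : ℕ) (σ j : ℕ))).2)

open Classical in
/-- Swap the labels at two positions, if they are unblocked. -/
noncomputable def swapMove (I : ℕ → ℕ → ℕ × ℕ) (e : Fin n × Fin n) (σ : Equiv.Perm (Fin n)) :
    Equiv.Perm (Fin n) :=
  if Unblocked I σ e.1 e.2 then σ * Equiv.swap e.1 e.2 else σ

lemma unblocked_mul_swap_iff {I : ℕ → ℕ → ℕ × ℕ} {σ : Equiv.Perm (Fin n)} {i j : Fin n} :
    Unblocked I (σ * Equiv.swap i j) i j ↔ Unblocked I σ i j := by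
  refine forall_congr' fun l => forall_congr' fun h1 => forall_congr' fun h2 => ?_
  simp [Equiv.swap_apply_of_ne_of_ne h1.ne' h2.ne, min_comm, max_comm]

lemma swapMove_involutive (I : ℕ → ℕ → ℕ × ℕ) (e : Fin n × Fin n) :
    Function.Involutive (swapMove I e) := by
  intro σ
  by_cases h : Unblocked I σ e.1 e.2
  · simp [swapMove, h, unblocked_mul_swap_iff, mul_assoc]
  · simp [swapMove, h]

lemma unblocked_of_succ (I : ℕ → ℕ → ℕ × ℕ) (σ : Equiv.Perm (Fin n)) {i j : Fin n}
    (h : (j : ℕ) = i + 1) : Unblocked I σ i j := by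
  intro l h1 h2
  rw [Fin.lt_def] at h1 h2
  omega

lemma inversionWeight_eq (p : ℕ → ℕ → ℝ) (σ : Equiv.Perm (Fin n)) :
    inversionWeight p σ
      = ∏ x : Fin n × Fin n, if x.1 < x.2 then pairWeight p (σ x.1) (σ x.2) else 1 := by
  rw [inversionWeight, Finset.prod_comm, Fintype.prod_prod_type, ← Equiv.prod_comp σ]
  refine Finset.prod_congr rfl fun a _ => ?_
  rw [← Equiv.prod_comp σ]
  refine Finset.prod_congr rfl fun b _ => ?_
  simp only [Equiv.symm_apply_apply, pairWeight, Fin.lt_def]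
  split_ifs <;> tauto

lemma inversionWeight_mul_swap_of_succ (p : ℕ → ℕ → ℝ) (σ : Equiv.Perm (Fin n)) {i j : Fin n}
    (h : (j : ℕ) = i + 1) :
    inversionWeight p (σ * Equiv.swap i j) * pairWeight p (σ i) (σ j)
      = inversionWeight p σ * pairWeight p (σ j) (σ i) := by
  have hij : i ≠ j := fun e => by rw [e] at h; omega
  have h1 : inversionWeight p (σ * Equiv.swap i j) = ∏ x : Fin n × Fin n,
      if Equiv.swap i j x.1 < Equiv.swap i j x.2 then pairWeight p (σ x.1) (σ x.2) else 1 := by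
    rw [inversionWeight_eq, ← Equiv.prod_comp ((Equiv.swap i j).prodCongr (Equiv.swap i j))]
    simp
  rw [h1, inversionWeight_eq]
  have e1 : pairWeight p (σ i) (σ j) = ∏ x : Fin n × Fin n,
      if x = (i, j) then pairWeight p (σ x.1) (σ x.2) else 1 := by
    rw [Finset.prod_ite_eq']; simp
  have e2 : pairWeight p (σ j) (σ i) = ∏ x : Fin n × Fin n,
      if x = (j, i) then pairWeight p (σ x.1) (σ x.2) else 1 := by
    rw [Finset.prod_ite_eq']; simp
  rw [e1, e2, ← Finset.prod_mul_distrib, ← Finset.prod_mul_distrib]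
  refine Finset.prod_congr rfl fun x _ => ?_
  obtain ⟨a, b⟩ := x
  simp only [Prod.mk.injEq]
  by_cases c1 : a = i ∧ b = j
  · obtain ⟨rfl, rfl⟩ := c1
    have : a < b := by rw [Fin.lt_def]; omega
    simp [this, this.le.not_gt, hij]
  by_cases c2 : a = j ∧ b = i
  · obtain ⟨rfl, rfl⟩ := c2
    have : b < a := by rw [Fin.lt_def]; omega
    simp [this, this.le.not_gt, hij]
  rw [if_neg c1, if_neg c2]
  congr 1
  have : Equiv.swap i j a < Equiv.swap i j b ↔ a < b := by
    simp only [Equiv.swap_apply_def, Fin.ext_iff] at *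
    split_ifs <;> simp only [Fin.lt_def] <;> omega
  simp only [this]

end Weight

namespace IsLeague

variable {n : ℕ} {q : ℝ} {p : ℕ → ℕ → ℝ} {I : ℕ → ℕ → ℕ × ℕ}

lemma pairWeight_pos (h : IsLeague n q p I) {u v : ℕ} (hu : u < n) : 0 < pairWeight p u v := by
  unfold pairWeight
  split_ifs with hvu
  · have := h.pos v u hvu hu
    have := h.lt_one v u hvu hu
    exact div_pos (by linarith) (by linarith)
  · exact one_pos

lemma inversionWeight_pos (h : IsLeague n q p I) (σ : Equiv.Perm (Fin n)) :
    0 < inversionWeight p σ := by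
  rw [inversionWeight_eq]
  refine Finset.prod_pos fun x _ => ?_
  split_ifs
  · exact h.pairWeight_pos (σ x.1).2
  · exact one_pos

lemma sum_inversionWeight_pos (h : IsLeague n q p I) :
    0 < ∑ σ : Equiv.Perm (Fin n), inversionWeight p σ :=
  Finset.sum_pos (fun σ _ => h.inversionWeight_pos σ) univ_nonempty

lemma inversionPi_pos (h : IsLeague n q p I) (σ : Equiv.Perm (Fin n)) : 0 < inversionPi p σ :=
  div_pos (h.inversionWeight_pos σ) h.sum_inversionWeight_pos

lemma sum_inversionPi (h : IsLeague n q p I) : ∑ σ : Equiv.Perm (Fin n), inversionPi p σ = 1 := by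
  simp_rw [inversionPi]
  rw [← Finset.sum_div, div_self h.sum_inversionWeight_pos.ne']

lemma inversionWeight_mul_swap (h : IsLeague n q p I) (d : ℕ) :
    ∀ (σ : Equiv.Perm (Fin n)) {i j : Fin n}, (j : ℕ) = i + 1 + d →
    (∀ l, i < l → l < j → pairWeight p (σ i) (σ l) = pairWeight p (σ j) (σ l) ∧
      pairWeight p (σ l) (σ i) = pairWeight p (σ l) (σ j)) →
    inversionWeight p (σ * Equiv.swap i j) * pairWeight p (σ i) (σ j)
      = inversionWeight p σ * pairWeight p (σ j) (σ i) := by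
  induction d with
  | zero => exact fun σ i j hij _ => inversionWeight_mul_swap_of_succ p σ hij
  | succ d ih =>
    intro σ i j hij hb
    obtain ⟨m, hm⟩ : ∃ m : Fin n, (m : ℕ) = i + 1 + d := ⟨⟨i + 1 + d, by omega⟩, rfl⟩
    have hmj : (j : ℕ) = m + 1 := by omega
    have him : i < m := by rw [Fin.lt_def]; omega
    have hmj' : m < j := by rw [Fin.lt_def]; omega
    have e : σ * Equiv.swap i j
        = σ * Equiv.swap m j * Equiv.swap i m * Equiv.swap m j := by
      have : Equiv.swap i j = Equiv.swap m j * Equiv.swap i m * (Equiv.swap m j)⁻¹ := by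
        rw [← Equiv.swap_apply_apply, Equiv.swap_apply_left,
          Equiv.swap_apply_of_ne_of_ne him.ne (him.trans hmj').ne]
      rw [this]; simp [mul_assoc]
    have h1 := inversionWeight_mul_swap_of_succ p σ hmj
    have hi : Equiv.swap m j i = i :=
      Equiv.swap_apply_of_ne_of_ne him.ne (him.trans hmj').ne
    have hj : Equiv.swap i m j = j :=
      Equiv.swap_apply_of_ne_of_ne (him.trans hmj').ne' hmj'.ne'
    have h2 := ih (σ * Equiv.swap m j) hm fun l h3 h4 => by
      have := Equiv.swap_apply_of_ne_of_ne h4.ne (h4.trans hmj').ne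
      simpa [hi, this] using hb l h3 (h4.trans hmj')
    have h3 := inversionWeight_mul_swap_of_succ p (σ * Equiv.swap m j * Equiv.swap i m) hmj
    simp only [Equiv.Perm.mul_apply, hi, hj, Equiv.swap_apply_left, Equiv.swap_apply_right]
      at h1 h2 h3
    obtain ⟨h4, h5⟩ := hb m him hmj'
    rw [e]
    rw [← h5] at h1
    rw [← h4] at h1
    have p1 : 0 < pairWeight p (σ m) (σ i) := h.pairWeight_pos (σ m).2
    have p2 : 0 < pairWeight p (σ i) (σ m) := h.pairWeight_pos (σ i).2
    refine mul_left_cancel₀ (mul_pos p1 p2).ne' ?_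
    linear_combination (pairWeight p (σ m) (σ i) * pairWeight p (σ i) (σ j)) * h3
      + (pairWeight p (σ m) (σ i)) ^ 2 * h2 + pairWeight p (σ m) (σ i)
        * pairWeight p (σ j) (σ i) * h1

lemma inversionWeight_mul_swap_of_unblocked (h : IsLeague n q p I) (σ : Equiv.Perm (Fin n))
    {i j : Fin n} (hij : i < j) (hu : Unblocked I σ i j) :
    inversionWeight p (σ * Equiv.swap i j) * pairWeight p (σ i) (σ j)
      = inversionWeight p σ * pairWeight p (σ j) (σ i) := by
  refine h.inversionWeight_mul_swap (j - i - 1) σ (by rw [Fin.lt_def] at hij; omega) ?_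
  intro l h1 h2
  have h3 := hu l h1 h2
  have key : ∀ u v w : ℕ, u < v → v < n → w < n → ¬ ((I u v).1 ≤ w ∧ w ≤ (I u v).2) →
      pairWeight p u w = pairWeight p v w ∧ pairWeight p w u = pairWeight p w v := by
    intro u v w huv hv hw hn
    have h4 := h.le_left u v huv hv
    have h5 := h.le_right u v huv hv
    unfold pairWeight
    rcases lt_or_ge w (I u v).1 with h6 | h6
    · have := h.below u v w huv hv h6
      simp [this, show w < u by omega, show w < v by omega, show ¬ u < w by omega,
        show ¬ v < w by omega]
    · have h7 : (I u v).2 < w := by omega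
      have := h.above u v w huv hv hw h7
      simp [this, show u < w by omega, show v < w by omega, show ¬ w < u by omega,
        show ¬ w < v by omega]
  have hne : (σ i : ℕ) ≠ σ j := fun e => hij.ne (σ.injective (Fin.ext e))
  rcases lt_or_gt_of_ne hne with hlt | hlt
  · rw [min_eq_left hlt.le, max_eq_right hlt.le] at h3
    exact key _ _ _ hlt (σ j).2 (σ l).2 h3
  · rw [min_eq_right hlt.le, max_eq_left hlt.le] at h3
    have := key _ _ _ hlt (σ i).2 (σ l).2 h3
    exact ⟨this.1.symm, this.2.symm⟩

end IsLeague

/-- Transition probabilities of the update at the positions `i`, `j`. -/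
noncomputable def swapStep {n : ℕ} (p : ℕ → ℕ → ℝ) (σ τ : Equiv.Perm (Fin n)) (i j : Fin n) : ℝ :=
  (p (min (σ i : ℕ) (σ j : ℕ)) (max (σ i : ℕ) (σ j : ℕ))) *
    (if τ = (if (σ i : ℕ) ≤ (σ j : ℕ) then σ else σ * Equiv.swap i j) then 1 else 0)
  + (1 - p (min (σ i : ℕ) (σ j : ℕ)) (max (σ i : ℕ) (σ j : ℕ))) *
    (if τ = (if (σ i : ℕ) ≤ (σ j : ℕ) then σ * Equiv.swap i j else σ) then 1 else 0)

/-- The chain of adjacent updates. -/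
noncomputable def adjacentChain (n : ℕ) (p : ℕ → ℕ → ℝ) :
    Matrix (Equiv.Perm (Fin n)) (Equiv.Perm (Fin n)) ℝ :=
  fun σ τ => (1 / ((n : ℝ) - 1)) * ∑ i : Fin n, ∑ j : Fin n,
    if (j : ℕ) = (i : ℕ) + 1 then swapStep p σ τ i j else 0

/-- The chain of unblocked updates. -/
noncomputable def unblockedChain (n : ℕ) (p : ℕ → ℕ → ℝ) (I : ℕ → ℕ → ℕ × ℕ) :
    Matrix (Equiv.Perm (Fin n)) (Equiv.Perm (Fin n)) ℝ :=
  fun σ τ => (1 / (n.choose 2 : ℝ)) * ∑ i : Fin n, ∑ j : Fin n,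
    if i < j then
      if ∀ l, i < l → l < j →
          ¬((I (min (σ i : ℕ) (σ j : ℕ)) (max (σ i : ℕ) (σ j : ℕ))).1 ≤ (σ l : ℕ) ∧
            (σ l : ℕ) ≤ (I (min (σ i : ℕ) (σ j : ℕ)) (max (σ i : ℕ) (σ j : ℕ))).2)
      then swapStep p σ τ i j
      else (if τ = σ then 1 else 0)
    else 0

/-- Pairs of positions `i < j`. -/
def ltPairs (n : ℕ) : Finset (Fin n × Fin n) := univ.filter fun e => e.1 < e.2

lemma adjacentPairs_subset_ltPairs (n : ℕ) : adjacentPairs n ⊆ ltPairs n := by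
  intro e he
  simp only [adjacentPairs, ltPairs, mem_filter, mem_univ, true_and, Fin.lt_def] at *
  omega

lemma card_ltPairs (n : ℕ) : #(ltPairs n) = n.choose 2 := by
  have h1 : #(ltPairs n) = ∑ i : Fin n, #(univ.filter fun j : Fin n => j < i) := by
    rw [ltPairs, Finset.card_filter, Fintype.sum_prod_type_right]
    simp_rw [Finset.card_filter]
  rw [h1]
  have h2 : ∀ i : Fin n, #(univ.filter fun j : Fin n => j < i) = i := by
    intro i
    rw [show (univ.filter fun j : Fin n => j < i) = Finset.Iio i by ext; simp, Fin.card_Iio]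
  simp_rw [h2]
  rw [Fin.sum_univ_eq_sum_range (fun i => i), Finset.sum_range_id, Nat.choose_two_right]

lemma card_adjacentPairs (n : ℕ) : #(adjacentPairs n) = n - 1 := by
  rcases n with _ | n
  · rfl
  rw [← Fintype.card_fin (n + 1 - 1), ← Finset.card_univ]
  symm
  refine Finset.card_bij (fun i _ => (Fin.castSucc i, Fin.succ i)) ?_ ?_ ?_
  · intro i _; simp [adjacentPairs]
  · intro i _ j _ h; simpa using h
  · rintro ⟨a, b⟩ h
    simp only [adjacentPairs, mem_filter, mem_univ, true_and] at h
    refine ⟨⟨a, by omega⟩, mem_univ _, ?_⟩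
    simp [Prod.ext_iff, Fin.ext_iff, h]

namespace IsLeague

variable {n : ℕ} {q : ℝ} {p : ℕ → ℕ → ℝ} {I : ℕ → ℕ → ℕ × ℕ}

lemma inversionPi_mul_swap (h : IsLeague n q p I) (σ : Equiv.Perm (Fin n))
    {i j : Fin n} (hij : i < j) (hu : Unblocked I σ i j) :
    inversionPi p (σ * Equiv.swap i j) * pairWeight p (σ i) (σ j)
      = inversionPi p σ * pairWeight p (σ j) (σ i) := by
  have := h.inversionWeight_mul_swap_of_unblocked σ hij hu
  simp only [inversionPi]
  rw [div_mul_eq_mul_div, this, div_mul_eq_mul_div]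

lemma swapStep_eq_heatBath (h : IsLeague n q p I) (σ τ : Equiv.Perm (Fin n))
    {i j : Fin n} (hij : i < j) (hu : Unblocked I σ i j) :
    swapStep p σ τ i j = heatBath (inversionPi p) (swapMove I (i, j)) σ τ := by
  have h1 := h.inversionPi_mul_swap σ hij hu
  have p1 := h.inversionPi_pos σ
  have p2 := h.inversionPi_pos (σ * Equiv.swap i j)
  have hne : (σ i : ℕ) ≠ σ j := fun e => hij.ne (σ.injective (Fin.ext e))
  simp only [swapStep, heatBath, swapMove, hu, if_true]
  rcases lt_or_gt_of_ne hne with hlt | hlt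
  · have q1 := h.pos _ _ hlt (σ j).2
    rw [pairWeight, if_neg hlt.not_gt, pairWeight, if_pos hlt] at h1
    rw [if_pos hlt.le, if_pos hlt.le, min_eq_left hlt.le, max_eq_right hlt.le]
    set P := p (σ i) (σ j)
    have e1 : inversionPi p (σ * Equiv.swap i j) * P = inversionPi p σ * (1 - P) := by
      field_simp at h1; linarith
    rw [eq_div_iff (by positivity)]
    split_ifs <;> linear_combination (norm := ring_nf)
    · linear_combination e1
    · linear_combination -e1
  · have q1 := h.pos _ _ hlt (σ i).2
    have q2 := h.lt_one _ _ hlt (σ i).2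
    rw [pairWeight, if_pos hlt, pairWeight, if_neg hlt.not_gt] at h1
    rw [if_neg hlt.not_ge, if_neg hlt.not_ge, min_eq_right hlt.le, max_eq_left hlt.le]
    set P := p (σ j) (σ i)
    have e1 : inversionPi p (σ * Equiv.swap i j) * (1 - P) = inversionPi p σ * P := by
      field_simp at h1; linarith
    rw [eq_div_iff (by positivity)]
    split_ifs <;> linear_combination (norm := ring_nf)
    · linear_combination -e1
    · linear_combination e1

lemma adjacentChain_eq (h : IsLeague n q p I) (hn : 1 ≤ n) :
    adjacentChain n p = heatBathChain (adjacentPairs n) (inversionPi p) (swapMove I) := by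
  ext σ τ
  simp only [adjacentChain, heatBathChain, card_adjacentPairs]
  rw [Nat.cast_sub hn, Nat.cast_one, adjacentPairs, Finset.sum_filter, Fintype.sum_prod_type]
  congr 1
  refine Finset.sum_congr rfl fun i _ => Finset.sum_congr rfl fun j _ => ?_
  split_ifs with hij
  · exact h.swapStep_eq_heatBath σ τ (by rw [Fin.lt_def]; omega) (unblocked_of_succ I σ hij)
  · rfl

lemma unblockedChain_eq (h : IsLeague n q p I) :
    unblockedChain n p I = heatBathChain (ltPairs n) (inversionPi p) (swapMove I) := by
  ext σ τ
  simp only [unblockedChain, heatBathChain, card_ltPairs]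
  rw [ltPairs, Finset.sum_filter, Fintype.sum_prod_type]
  congr 1
  refine Finset.sum_congr rfl fun i _ => Finset.sum_congr rfl fun j _ => ?_
  split_ifs with hij hu hτ
  · exact h.swapStep_eq_heatBath σ τ hij hu
  · have hm : swapMove I (i, j) σ = σ := if_neg hu
    have := h.inversionPi_pos σ
    simp only [heatBath, hm, hτ, if_true]
    field_simp
  · have hm : swapMove I (i, j) σ = σ := if_neg hu
    simp [heatBath, hm, hτ]
  · rfl

lemma inversionPi_le_of_descent (h : IsLeague n q p I) (σ : Equiv.Perm (Fin n)) (a b : Fin n)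
    (hab : (a : ℕ) + 1 = b) (hσ : (σ b : ℕ) < σ a) :
    inversionPi p σ ≤ q * inversionPi p (σ * Equiv.swap a b) := by
  have h1 := h.inversionPi_mul_swap σ (by rw [Fin.lt_def]; omega)
    (unblocked_of_succ I σ hab.symm)
  rw [pairWeight, if_pos hσ, pairWeight, if_neg hσ.not_gt, mul_one] at h1
  have q1 := h.pos _ _ hσ (σ a).2
  rw [← h1, mul_comm q]
  refine mul_le_mul_of_nonneg_left ?_ (h.inversionPi_pos _).le
  rw [div_le_iff₀ q1]
  exact h.ratio _ _ hσ (σ a).2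

end IsLeague

section Apriori

variable {n : ℕ}

lemma sum_mul_perm_le (σ : Equiv.Perm (Fin n)) : ∑ i : Fin n, (i : ℕ) * σ i ≤ n ^ 3 := by
  calc ∑ i : Fin n, (i : ℕ) * σ i ≤ ∑ i : Fin n, n * n :=
        Finset.sum_le_sum fun i _ => Nat.mul_le_mul i.2.le (σ i).2.le
    _ = n ^ 3 := by simp; ring

lemma sum_mul_perm_lt_of_descent (σ : Equiv.Perm (Fin n)) {a b : Fin n} (hab : (a : ℕ) + 1 = b)
    (hσ : (σ b : ℕ) < σ a) :
    ∑ i : Fin n, (i : ℕ) * σ i < ∑ i : Fin n, (i : ℕ) * (σ * Equiv.swap a b) i := by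
  have hne : a ≠ b := fun e => by rw [e] at hab; omega
  have hb : b ∈ univ.erase a := by simp [hne.symm]
  rw [← Finset.add_sum_erase _ _ (mem_univ a), ← Finset.add_sum_erase _ _ hb,
    ← Finset.add_sum_erase univ (fun i : Fin n => (i : ℕ) * ((σ * Equiv.swap a b) i : ℕ))
      (mem_univ a),
    ← Finset.add_sum_erase _ (fun i : Fin n => (i : ℕ) * ((σ * Equiv.swap a b) i : ℕ)) hb]
  have h : ∑ x ∈ (univ.erase a).erase b, (x : ℕ) * ((σ * Equiv.swap a b) x : ℕ)
      = ∑ x ∈ (univ.erase a).erase b, (x : ℕ) * (σ x : ℕ) := by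
    refine Finset.sum_congr rfl fun x hx => ?_
    simp only [mem_erase, mem_univ, and_true] at hx
    rw [Equiv.Perm.mul_apply, Equiv.swap_apply_of_ne_of_ne hx.2 hx.1]
  rw [h]
  simp only [Equiv.Perm.mul_apply, Equiv.swap_apply_left, Equiv.swap_apply_right]
  rw [← hab]
  nlinarith

lemma eq_one_of_no_descent (σ : Equiv.Perm (Fin n))
    (h : ∀ a b : Fin n, (a : ℕ) + 1 = b → ¬ (σ b : ℕ) < σ a) : σ = 1 := by
  rcases n with _ | n
  · exact Subsingleton.elim _ _
  have hm : StrictMono σ := by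
    rw [Fin.strictMono_iff_lt_succ]
    intro i
    have h1 := h i.castSucc i.succ (by simp)
    have h2 : σ i.castSucc ≠ σ i.succ := fun e => (Fin.castSucc_lt_succ (i := i)).ne (σ.injective e)
    exact lt_of_le_of_ne (not_lt.1 h1) h2
  have : hm.orderIsoOfSurjective σ σ.surjective = OrderIso.refl _ := Subsingleton.elim _ _
  ext i
  have := congrArg (fun e : Fin (n + 1) ≃o Fin (n + 1) => (e i : ℕ)) this
  simpa using this

variable {q : ℝ} {π : Equiv.Perm (Fin n) → ℝ}

lemma swapEnergy_le_adjacentEnergy (hpos : ∀ σ, 0 < π σ) (f : Equiv.Perm (Fin n) → ℝ)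
    (σ : Equiv.Perm (Fin n)) {a b : Fin n} (hab : (a : ℕ) + 1 = b) :
    swapEnergy π f (σ, (a, b)) ≤ adjacentEnergy π f := by
  refine Finset.single_le_sum (f := swapEnergy π f) (fun x _ => swapEnergy_nonneg hpos f x) ?_
  simp [adjacentPairs, hab.symm]

lemma adjacentEnergy_nonneg (hpos : ∀ σ, 0 < π σ) (f : Equiv.Perm (Fin n) → ℝ) :
    0 ≤ adjacentEnergy π f := Finset.sum_nonneg fun x _ => swapEnergy_nonneg hpos f x

lemma sqrt_mul_abs_sub_le (hpos : ∀ σ, 0 < π σ)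
    (hgain : ∀ (σ : Equiv.Perm (Fin n)) (a b : Fin n), (a : ℕ) + 1 = b → (σ b : ℕ) < σ a →
      π σ ≤ π (σ * Equiv.swap a b)) (f : Equiv.Perm (Fin n) → ℝ) (k : ℕ) :
    ∀ σ : Equiv.Perm (Fin n), n ^ 3 ≤ k + ∑ i : Fin n, (i : ℕ) * σ i →
      √(π σ) * |f σ - f 1| ≤ k * √(2 * adjacentEnergy π f) := by
  induction k with
  | zero =>
    intro σ hσ
    have : σ = 1 := by
      refine eq_one_of_no_descent σ fun a b hab hd => ?_
      have h1 := sum_mul_perm_lt_of_descent σ hab hd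
      have h2 := sum_mul_perm_le (σ * Equiv.swap a b)
      omega
    simp [this]
  | succ k ih =>
    intro σ hσ
    by_cases h : ∃ a b : Fin n, (a : ℕ) + 1 = b ∧ (σ b : ℕ) < σ a
    · obtain ⟨a, b, hab, hd⟩ := h
      have h1 := sum_mul_perm_lt_of_descent σ hab hd
      have h2 := ih (σ * Equiv.swap a b) (by omega)
      have h3 := hgain σ a b hab hd
      have h4 := swapEnergy_le_adjacentEnergy hpos f σ hab
      simp only [swapEnergy] at h4
      have h5 := le_two_mul_conductance (hpos σ) h3
      set σ' := σ * Equiv.swap a b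
      have h6 : √(π σ) * |f σ - f σ'| ≤ √(2 * adjacentEnergy π f) := by
        refine Real.le_sqrt_of_sq_le ?_
        rw [mul_pow, Real.sq_sqrt (hpos σ).le, sq_abs]
        calc π σ * (f σ - f σ') ^ 2 ≤ 2 * conductance (π σ) (π σ') * (f σ - f σ') ^ 2 := by gcongr
          _ ≤ _ := by linarith
      calc √(π σ) * |f σ - f 1| ≤ √(π σ) * (|f σ - f σ'| + |f σ' - f 1|) := by
            gcongr; exact abs_sub_le _ _ _
        _ = √(π σ) * |f σ - f σ'| + √(π σ) * |f σ' - f 1| := by ring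
        _ ≤ √(2 * adjacentEnergy π f) + √(π σ') * |f σ' - f 1| := by
            gcongr
        _ ≤ √(2 * adjacentEnergy π f) + k * √(2 * adjacentEnergy π f) := by gcongr
        _ = _ := by push_cast; ring
    · push Not at h
      have : σ = 1 := eq_one_of_no_descent σ fun a b hab => not_lt.2 (h a b hab)
      rw [this]; simp; positivity

lemma chainVar_le_adjacentEnergy (hpos : ∀ σ, 0 < π σ) (hsum : ∑ σ, π σ = 1)
    (hgain : ∀ (σ : Equiv.Perm (Fin n)) (a b : Fin n), (a : ℕ) + 1 = b → (σ b : ℕ) < σ a →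
      π σ ≤ π (σ * Equiv.swap a b)) (f : Equiv.Perm (Fin n) → ℝ) :
    chainVar π f ≤ 2 * (n.factorial : ℝ) * n ^ 6 * adjacentEnergy π f := by
  have h1 := chainVar_eq_sum_sq hsum f (f 1)
  have hD := adjacentEnergy_nonneg hpos f
  have h2 : ∀ σ : Equiv.Perm (Fin n), π σ * (f σ - f 1) ^ 2
      ≤ (n : ℝ) ^ 6 * (2 * adjacentEnergy π f) := by
    intro σ
    have h3 := sqrt_mul_abs_sub_le hpos hgain f (n ^ 3) σ (Nat.le_add_right _ _)
    have h4 := pow_le_pow_left₀ (by positivity) h3 2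
    rw [mul_pow, mul_pow, Real.sq_sqrt (hpos σ).le, Real.sq_sqrt (by positivity), sq_abs] at h4
    refine h4.trans (le_of_eq ?_)
    push_cast; ring
  calc chainVar π f ≤ ∑ σ, π σ * (f σ - f 1) ^ 2 := by
        rw [h1]; nlinarith [sq_nonneg (∑ σ, π σ * f σ - f 1)]
    _ ≤ ∑ σ : Equiv.Perm (Fin n), (n : ℝ) ^ 6 * (2 * adjacentEnergy π f) :=
        Finset.sum_le_sum fun σ _ => h2 σ
    _ = _ := by
        rw [Finset.sum_const, Finset.card_univ, Fintype.card_perm, Fintype.card_fin]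
        simp; ring

end Apriori

namespace IsLeague

variable {n : ℕ} {q : ℝ} {p : ℕ → ℕ → ℝ} {I : ℕ → ℕ → ℕ × ℕ}

lemma sum_edgeEnergy_adjacentPairs (π f : Equiv.Perm (Fin n) → ℝ) :
    ∑ e ∈ adjacentPairs n, edgeEnergy π (swapMove I e) f = adjacentEnergy π f := by
  rw [adjacentEnergy, Finset.sum_product_right]
  refine Finset.sum_congr rfl fun e he => Finset.sum_congr rfl fun σ _ => ?_
  have : Unblocked I σ e.1 e.2 := unblocked_of_succ I σ (by simpa [adjacentPairs] using he)
  simp [swapMove, this, swapEnergy]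

open Classical in
lemma sum_edgeEnergy_ltPairs_le (h : IsLeague n q p I) (hq0 : 0 < q) (hq : q < 1 / 2)
    (f : Equiv.Perm (Fin n) → ℝ) :
    ∑ e ∈ ltPairs n, edgeEnergy (inversionPi p) (swapMove I e) f
      ≤ n * (comparisonConst q * adjacentEnergy (inversionPi p) f) := by
  set π : Equiv.Perm (Fin n) → ℝ := inversionPi p
  have hpos : ∀ σ, 0 < π σ := h.inversionPi_pos
  calc ∑ e ∈ ltPairs n, edgeEnergy π (swapMove I e) f
      ≤ ∑ e ∈ ltPairs n, ∑ σ : Equiv.Perm (Fin n), ∑ k ∈ range n,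
        if IsConsecutive (I k (k + 1)).1 (I k (k + 1)).2 σ e.1 e.2
          then swapEnergy π f (σ, e) else 0 := by
        refine Finset.sum_le_sum fun e he => Finset.sum_le_sum fun σ _ => ?_
        have hnn : ∀ k ∈ range n, (0 : ℝ) ≤
            if IsConsecutive (I k (k + 1)).1 (I k (k + 1)).2 σ e.1 e.2
            then swapEnergy π f (σ, e) else 0 := by
          intro k _
          split_ifs
          · exact swapEnergy_nonneg hpos f _
          · exact le_rfl
        by_cases hu : Unblocked I σ e.1 e.2
        · have hlt : e.1 < e.2 := by simpa [ltPairs] using he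
          have hne : (σ e.1 : ℕ) ≠ σ e.2 := fun c => hlt.ne (σ.injective (Fin.ext c))
          have h1 : min (σ e.1 : ℕ) (σ e.2) < max (σ e.1 : ℕ) (σ e.2) := min_lt_max.2 hne
          have h2 : max (σ e.1 : ℕ) (σ e.2) < n := max_lt (σ e.1).2 (σ e.2).2
          obtain ⟨k, hk, hIk⟩ := h.exists_succ _ _ h1 h2
          have h3 := h.le_left _ _ h1 h2
          have h4 := h.le_right _ _ h1 h2
          have hc : IsConsecutive (I k (k + 1)).1 (I k (k + 1)).2 σ e.1 e.2 := by
            rw [← hIk]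
            exact ⟨hlt, ⟨h3.trans (min_le_left _ _), (le_max_left _ _).trans h4⟩,
              ⟨h3.trans (min_le_right _ _), (le_max_right _ _).trans h4⟩, hu⟩
          refine le_trans (le_of_eq ?_)
            (Finset.single_le_sum hnn (Finset.mem_range.2 hk))
          rw [if_pos hc]
          simp [swapMove, hu, swapEnergy]
        · simp only [swapMove, hu, if_false, sub_self]
          simpa using Finset.sum_nonneg hnn
    _ = ∑ k ∈ range n, ∑ e ∈ ltPairs n, ∑ σ : Equiv.Perm (Fin n),
        if IsConsecutive (I k (k + 1)).1 (I k (k + 1)).2 σ e.1 e.2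
          then swapEnergy π f (σ, e) else 0 := by
        rw [Finset.sum_comm]
        refine (Finset.sum_congr rfl fun σ _ => Finset.sum_comm).trans ?_
        rw [Finset.sum_comm]
        refine Finset.sum_congr rfl fun k _ => Finset.sum_comm
    _ ≤ ∑ k ∈ range n, comparisonConst q * adjacentEnergy π f := by
        refine Finset.sum_le_sum fun k _ => ?_
        refine le_trans (le_of_eq ?_) (sum_consecutive_le hq0 hq hpos
          h.inversionPi_le_of_descent f (I k (k + 1)).1 (I k (k + 1)).2)
        rw [Finset.sum_comm, Finset.sum_filter, Fintype.sum_prod_type]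
        refine Finset.sum_congr rfl fun σ _ => ?_
        rw [ltPairs, Finset.sum_filter]
        refine Finset.sum_congr rfl fun e _ => ?_
        by_cases hlt : e.1 < e.2
        · simp [hlt]
        · simp only [hlt, if_false]
          rw [if_neg fun hc => hlt hc.lt]
    _ = _ := by simp

lemma adjacentPairs_nonempty (hn : 2 ≤ n) : (adjacentPairs n).Nonempty := by
  rw [← Finset.card_pos, card_adjacentPairs]; omega

lemma ltPairs_nonempty (hn : 2 ≤ n) : (ltPairs n).Nonempty :=
  (adjacentPairs_nonempty hn).mono (adjacentPairs_subset_ltPairs n)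

lemma adjacentChain_isReversibleChain (h : IsLeague n q p I) (hn : 2 ≤ n) :
    IsReversibleChain (adjacentChain n p) (inversionPi p) := by
  rw [h.adjacentChain_eq (by omega)]
  exact heatBathChain_isReversibleChain h.inversionPi_pos h.sum_inversionPi
    (adjacentPairs_nonempty hn) (swapMove_involutive I)

lemma unblockedChain_isReversibleChain (h : IsLeague n q p I) (hn : 2 ≤ n) :
    IsReversibleChain (unblockedChain n p I) (inversionPi p) := by
  rw [h.unblockedChain_eq]
  exact heatBathChain_isReversibleChain h.inversionPi_pos h.sum_inversionPi
    (ltPairs_nonempty hn) (swapMove_involutive I)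

lemma adjacentEnergy_eq (h : IsLeague n q p I) (hn : 2 ≤ n) (f : Equiv.Perm (Fin n) → ℝ) :
    adjacentEnergy (inversionPi p) f
      = 2 * ((n : ℝ) - 1) * chainEnergy (adjacentChain n p) (inversionPi p) f := by
  have hn' : (2 : ℝ) ≤ n := by exact_mod_cast hn
  rw [h.adjacentChain_eq (by omega), heatBathChain_energy h.inversionPi_pos
    (adjacentPairs_nonempty hn) (swapMove_involutive I), sum_edgeEnergy_adjacentPairs,
    card_adjacentPairs, Nat.cast_sub (by omega), Nat.cast_one]
  have : (n : ℝ) - 1 ≠ 0 := by linarith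
  field_simp

lemma sum_edgeEnergy_ltPairs_eq (h : IsLeague n q p I) (hn : 2 ≤ n)
    (f : Equiv.Perm (Fin n) → ℝ) :
    ∑ e ∈ ltPairs n, edgeEnergy (inversionPi p) (swapMove I e) f
      = n * ((n : ℝ) - 1) * chainEnergy (unblockedChain n p I) (inversionPi p) f := by
  have hn' : (2 : ℝ) ≤ n := by exact_mod_cast hn
  rw [h.unblockedChain_eq, heatBathChain_energy h.inversionPi_pos
    (ltPairs_nonempty hn) (swapMove_involutive I), card_ltPairs, Nat.cast_choose_two]
  have : (n : ℝ) - 1 ≠ 0 := by linarith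
  have : (n : ℝ) ≠ 0 := by linarith
  field_simp

lemma chainEnergy_unblockedChain_le (h : IsLeague n q p I) (hn : 2 ≤ n) (hq0 : 0 < q)
    (hq : q < 1 / 2) (f : Equiv.Perm (Fin n) → ℝ) :
    chainEnergy (unblockedChain n p I) (inversionPi p) f
      ≤ 2 * comparisonConst q * chainEnergy (adjacentChain n p) (inversionPi p) f := by
  have hn' : (2 : ℝ) ≤ n := by exact_mod_cast hn
  have h1 := h.sum_edgeEnergy_ltPairs_le hq0 hq f
  rw [h.sum_edgeEnergy_ltPairs_eq hn, h.adjacentEnergy_eq hn] at h1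
  have h2 : 0 < (n : ℝ) * (n - 1) := mul_pos (by linarith) (by linarith)
  refine le_of_mul_le_mul_left (h1.trans (le_of_eq ?_)) h2
  ring

lemma chainVar_le_adjacentChain (h : IsLeague n q p I) (hn : 2 ≤ n) (hq : q < 1 / 2)
    (f : Equiv.Perm (Fin n) → ℝ) :
    chainVar (inversionPi p) f ≤ 4 * (n.factorial : ℝ) * n ^ 7
      * chainEnergy (adjacentChain n p) (inversionPi p) f := by
  have hn' : (2 : ℝ) ≤ n := by exact_mod_cast hn
  have h1 := chainVar_le_adjacentEnergy h.inversionPi_pos h.sum_inversionPi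
    (fun σ a b hab hd => (h.inversionPi_le_of_descent σ a b hab hd).trans
      (mul_le_of_le_one_left (h.inversionPi_pos _).le (by linarith))) f
  have h0 := adjacentEnergy_nonneg h.inversionPi_pos f
  rw [h.adjacentEnergy_eq hn] at h0 h1
  set E := chainEnergy (adjacentChain n p) (inversionPi p) f
  have hE : 0 ≤ E := nonneg_of_mul_nonneg_right h0 (by linarith)
  calc _ ≤ _ := h1
    _ ≤ 2 * (n.factorial : ℝ) * n ^ 6 * (2 * n * E) := by gcongr; linarith
    _ = _ := by ring

lemma chainVar_le_unblockedChain (h : IsLeague n q p I) (hn : 2 ≤ n) (hq : q < 1 / 2)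
    (f : Equiv.Perm (Fin n) → ℝ) :
    chainVar (inversionPi p) f ≤ 2 * (n.factorial : ℝ) * n ^ 8
      * chainEnergy (unblockedChain n p I) (inversionPi p) f := by
  have hn' : (2 : ℝ) ≤ n := by exact_mod_cast hn
  have h1 := chainVar_le_adjacentEnergy h.inversionPi_pos h.sum_inversionPi
    (fun σ a b hab hd => (h.inversionPi_le_of_descent σ a b hab hd).trans
      (mul_le_of_le_one_left (h.inversionPi_pos _).le (by linarith))) f
  have h2 : adjacentEnergy (inversionPi p) f
      ≤ n * ((n : ℝ) - 1) * chainEnergy (unblockedChain n p I) (inversionPi p) f := by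
    rw [← h.sum_edgeEnergy_ltPairs_eq hn, ← sum_edgeEnergy_adjacentPairs (I := I)]
    exact Finset.sum_le_sum_of_subset_of_nonneg (adjacentPairs_subset_ltPairs n)
      fun _ _ _ => edgeEnergy_nonneg h.inversionPi_pos _ _
  have h0 := (adjacentEnergy_nonneg h.inversionPi_pos f).trans h2
  set E := chainEnergy (unblockedChain n p I) (inversionPi p) f
  have hE : 0 ≤ E :=
    nonneg_of_mul_nonneg_right h0 (mul_pos (by linarith) (by linarith))
  calc _ ≤ _ := h1
    _ ≤ 2 * (n.factorial : ℝ) * n ^ 6 * (n * n * E) := by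
        gcongr
        refine h2.trans ?_
        gcongr
        linarith
    _ = _ := by ring

end IsLeague

namespace STree

lemma numLeaves_pos (T : STree) : 0 < T.numLeaves := by
  induction T with
  | leaf => exact one_pos
  | node sL sC sR l c r ihl ihc ihr => simp only [numLeaves]; omega

lemma lcaRange_bounds (T : STree) : ∀ i j : ℕ, i < j → j < T.numLeaves →
    (T.lcaRange i j).1 ≤ i ∧ j ≤ (T.lcaRange i j).2 := by
  induction T with
  | leaf => intro i j h1 h2; simp only [numLeaves] at h2; omega
  | node sL sC sR l c r ihl ihc ihr =>
    intro i j h1 h2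
    simp only [numLeaves] at h2
    simp only [lcaRange]
    split_ifs with h3 h4 h5
    · exact ihl i j h1 h3
    · have := ihc (i - l.numLeaves) (j - l.numLeaves) (by omega) (by omega)
      simp only; omega
    · have := ihr (i - l.numLeaves - c.numLeaves) (j - l.numLeaves - c.numLeaves) (by omega)
        (by omega)
      simp only; omega
    · simp only; omega

lemma exists_lcaRange_eq_succ (T : STree) : ∀ i j : ℕ, i < j → j < T.numLeaves →
    ∃ k, k + 1 < T.numLeaves ∧ T.lcaRange i j = T.lcaRange k (k + 1) := by
  induction T with
  | leaf => intro i j h1 h2; simp only [numLeaves] at h2; omega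
  | node sL sC sR l c r ihl ihc ihr =>
    intro i j h1 h2
    have pl := l.numLeaves_pos
    have pc := c.numLeaves_pos
    have pr := r.numLeaves_pos
    simp only [numLeaves] at h2 ⊢
    simp only [lcaRange]
    split_ifs with h3 h4 h5
    · obtain ⟨k, hk, e⟩ := ihl i j h1 h3
      exact ⟨k, by omega, by rw [if_pos hk, e]⟩
    · obtain ⟨k, hk, e⟩ := ihc (i - l.numLeaves) (j - l.numLeaves) (by omega) (by omega)
      refine ⟨k + l.numLeaves, by omega, ?_⟩
      rw [if_neg (by omega), if_pos (by omega), e, show k + l.numLeaves - l.numLeaves = k by omega,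
        show k + l.numLeaves + 1 - l.numLeaves = k + 1 by omega]
    · obtain ⟨k, hk, e⟩ := ihr (i - l.numLeaves - c.numLeaves) (j - l.numLeaves - c.numLeaves)
        (by omega) (by omega)
      refine ⟨k + l.numLeaves + c.numLeaves, by omega, ?_⟩
      rw [if_neg (by omega), if_neg (by omega), if_pos (by omega), e,
        show k + l.numLeaves + c.numLeaves - l.numLeaves - c.numLeaves = k by omega,
        show k + l.numLeaves + c.numLeaves + 1 - l.numLeaves - c.numLeaves = k + 1 by omega]
    · refine ⟨l.numLeaves - 1, by omega, ?_⟩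
      rw [if_neg (by omega), if_neg (by omega), if_neg (by omega)]

lemma pSwap_below (T : STree) : ∀ u v w : ℕ, u < v → v < T.numLeaves →
    w < (T.lcaRange u v).1 → T.pSwap w u = T.pSwap w v := by
  induction T with
  | leaf => intro u v w h1 h2; simp only [numLeaves] at h2; omega
  | node sL sC sR l c r ihl ihc ihr =>
    intro u v w h1 h2
    simp only [numLeaves] at h2
    simp only [lcaRange]
    split_ifs with h3 h4 h5
    · intro hw
      simp only [pSwap]
      rw [if_pos (h1.trans h3), if_pos h3]
      exact ihl u v w h1 h3 hw
    · intro hw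
      simp only at hw
      have hb := (c.lcaRange_bounds (u - l.numLeaves) (v - l.numLeaves) (by omega) (by omega)).1
      simp only [pSwap]
      split_ifs <;>
        first | omega | rfl | exact ihc _ _ _ (by omega) (by omega) (by omega)
    · intro hw
      simp only at hw
      have hb := (r.lcaRange_bounds (u - l.numLeaves - c.numLeaves)
        (v - l.numLeaves - c.numLeaves) (by omega) (by omega)).1
      simp only [pSwap]
      split_ifs <;>
        first | omega | rfl | exact ihr _ _ _ (by omega) (by omega) (by omega)
    · intro hw; simp only at hw; omega

lemma pSwap_above (T : STree) : ∀ u v w : ℕ, u < v → v < T.numLeaves → w < T.numLeaves →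
    (T.lcaRange u v).2 < w → T.pSwap u w = T.pSwap v w := by
  induction T with
  | leaf => intro u v w h1 h2; simp only [numLeaves] at h2; omega
  | node sL sC sR l c r ihl ihc ihr =>
    intro u v w h1 h2 h2'
    simp only [numLeaves] at h2 h2'
    simp only [lcaRange]
    split_ifs with h3 h4 h5
    · intro hw
      simp only [pSwap]
      rw [if_pos (h1.trans h3), if_pos h3]
      split_ifs with h6 h7
      · exact ihl u v w h1 h3 h6 hw
      · rfl
      · rfl
    · intro hw
      simp only at hw
      have hb := (c.lcaRange_bounds (u - l.numLeaves) (v - l.numLeaves) (by omega) (by omega)).2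
      simp only [pSwap]
      split_ifs <;>
        first | omega | rfl | exact ihc _ _ _ (by omega) (by omega) (by omega) (by omega)
    · intro hw
      simp only at hw
      have hb := (r.lcaRange_bounds (u - l.numLeaves - c.numLeaves)
        (v - l.numLeaves - c.numLeaves) (by omega) (by omega)).2
      simp only [pSwap]
      split_ifs <;>
        first | omega | rfl | exact ihr _ _ _ (by omega) (by omega) (by omega) (by omega)
    · intro hw; simp only at hw; omega

lemma pSwap_bounds (q : ℝ) (T : STree) : T.Valid → T.RatioBound q → ∀ u v : ℕ, u < v →
    v < T.numLeaves → 0 < T.pSwap u v ∧ T.pSwap u v < 1 ∧ 1 - T.pSwap u v ≤ q * T.pSwap u v := by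
  have key : ∀ a b : ℝ, 0 < a → a ≤ q * b → 0 < b →
      0 < b / (b + a) ∧ b / (b + a) < 1 ∧ 1 - b / (b + a) ≤ q * (b / (b + a)) := by
    intro a b ha hab hb
    refine ⟨by positivity, by rw [div_lt_one (by positivity)]; linarith, ?_⟩
    have e : 1 - b / (b + a) = a / (b + a) := by field_simp; ring
    rw [e, ← mul_div_assoc]
    gcongr
  induction T with
  | leaf => intro _ _ u v h1 h2; simp only [numLeaves] at h2; omega
  | node sL sC sR l c r ihl ihc ihr =>
    intro hV hR u v h1 h2
    simp only [numLeaves] at h2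
    obtain ⟨v1, v2, v3, -, -, vl, vc, vr⟩ := hV
    obtain ⟨r1, r2, rl, rc, rr⟩ := hR
    have v4 := v1.trans v2
    have v5 := v4.trans v3
    rw [div_le_iff₀ v4] at r1
    rw [div_le_iff₀ v5] at r2
    simp only [pSwap]
    split_ifs with h3 h4 h5 h6 h7
    · exact ihl vl rl u v h1 h3
    · exact key sL sC v1 r1 v4
    · exact key sL sR v1 (v2.le.trans r2) v5
    · exact ihc vc rc _ _ (by omega) (by omega)
    · exact key sC sR v4 r2 v5
    · exact ihr vr rr _ _ (by omega) (by omega)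

/-- Capping the swap probabilities of a tree at `1 - δ` yields a league. -/
lemma isLeague_min {q qb δ : ℝ} {T : STree} (hV : T.Valid) (hR : T.RatioBound qb) (hqb : qb ≤ q)
    (hq : 1 / 4 ≤ q) (hδ : 0 < δ) (hδ' : δ ≤ 1 / 8) :
    IsLeague T.numLeaves q (fun u v => min (T.pSwap u v) (1 - δ)) T.lcaRange where
  pos u v h1 h2 := lt_min (pSwap_bounds qb T hV hR u v h1 h2).1 (by linarith)
  lt_one u v h1 h2 := (min_le_right _ _).trans_lt (by linarith)
  ratio u v h1 h2 := by
    have h := pSwap_bounds qb T hV hR u v h1 h2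
    rcases min_choice (T.pSwap u v) (1 - δ) with e | e <;> simp only [e]
    · nlinarith
    · nlinarith
  le_left u v h1 h2 := (T.lcaRange_bounds u v h1 h2).1
  le_right u v h1 h2 := (T.lcaRange_bounds u v h1 h2).2
  below u v w h1 h2 h3 := by simp only [T.pSwap_below u v w h1 h2 h3]
  above u v w h1 h2 h3 h4 := by simp only [T.pSwap_above u v w h1 h2 h3 h4]
  exists_succ u v h1 h2 := by
    obtain ⟨k, hk, e⟩ := T.exists_lcaRange_eq_succ u v h1 h2
    exact ⟨k, by omega, e⟩

lemma isLeague {q qb : ℝ} {T : STree} (hV : T.Valid) (hR : T.RatioBound qb) (hqb : qb ≤ q) :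
    IsLeague T.numLeaves q T.pSwap T.lcaRange where
  pos u v h1 h2 := (pSwap_bounds qb T hV hR u v h1 h2).1
  lt_one u v h1 h2 := (pSwap_bounds qb T hV hR u v h1 h2).2.1
  ratio u v h1 h2 := by
    have h := pSwap_bounds qb T hV hR u v h1 h2
    nlinarith
  le_left u v h1 h2 := (T.lcaRange_bounds u v h1 h2).1
  le_right u v h1 h2 := (T.lcaRange_bounds u v h1 h2).2
  below := T.pSwap_below
  above := T.pSwap_above
  exists_succ u v h1 h2 := by
    obtain ⟨k, hk, e⟩ := T.exists_lcaRange_eq_succ u v h1 h2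
    exact ⟨k, by omega, e⟩

end STree

lemma leagueP_eq (T : STree) : leagueP T = adjacentChain T.numLeaves T.pSwap := rfl

lemma treeP_eq (T : STree) : treeP T = unblockedChain T.numLeaves T.pSwap T.lcaRange := rfl

lemma treePi_eq (T : STree) : treePi T = inversionPi T.pSwap := rfl

namespace IsReversibleChain

variable {Ω : Type*} [Fintype Ω] [DecidableEq Ω] {P Q : Matrix Ω Ω ℝ} {π ρ : Ω → ℝ}

lemma mixingTime_le (h : IsReversibleChain P π) {s : ℕ}
    (hs : ∀ x, ∑ y, |(P ^ s) x y - π y| ≤ 1 / 2) : mixingTime P π ≤ s :=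
  Nat.sInf_le fun x t hst => by linarith [h.sum_abs_sub_antitone hst x, hs x]

/-- Under a Poincaré inequality, the distance to stationarity falls below any level. -/
lemma exists_sum_abs_sub_le (h : IsReversibleChain P π)
    (hpsd : ∀ f, ∑ x, π x * (P.mulVec f) x ^ 2 ≤ ∑ x, π x * (f x * (P.mulVec f) x))
    {R : ℝ} (hR : 0 < R) (hgap : ∀ f, chainVar π f ≤ R * chainEnergy P π f) :
    ∃ s : ℕ, ∀ x, ∑ y, |(P ^ s) x y - π y| ≤ 1 / 2 := by
  set S := ∑ y, 1 / π y with hS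
  refine ⟨⌈R * Real.log (4 * S)⌉₊, fun x => ?_⟩
  have hx : 1 / π x ≤ S := Finset.single_le_sum (f := fun y => 1 / π y)
    (fun y _ => (one_div_pos.2 (h.pos y)).le) (mem_univ x)
  have hS0 : 0 < S := (one_div_pos.2 (h.pos x)).trans_le hx
  set s := ⌈R * Real.log (4 * S)⌉₊
  have h1 := h.sum_abs_sub_le_of_gap hpsd hR hgap x s
  have h2 : R * Real.log (4 * S) ≤ s := Nat.le_ceil _
  have h3 : Real.exp (-s / R) ≤ 1 / (4 * S) := by
    rw [one_div, ← Real.exp_log (inv_pos.2 (by positivity : 0 < 4 * S)), Real.log_inv,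
      Real.exp_le_exp, neg_div, neg_le_neg_iff, le_div_iff₀ hR, mul_comm]
    exact h2
  have h4 : Real.exp (-s / R) / π x ≤ (1 / 2) ^ 2 := by
    rw [div_eq_mul_one_div]
    calc _ ≤ 1 / (4 * S) * S := mul_le_mul h3 hx (one_div_pos.2 (h.pos x)).le (by positivity)
      _ = _ := by field_simp; norm_num
  exact le_of_sq_le_sq (h1.trans h4) (by norm_num)

lemma sum_abs_sub_mixingTime_le (h : IsReversibleChain P π)
    (hex : ∃ s : ℕ, ∀ x, ∑ y, |(P ^ s) x y - π y| ≤ 1 / 2) (x : Ω) :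
    ∑ y, |(P ^ mixingTime P π) x y - π y| ≤ 1 / 2 := by
  obtain ⟨s, hs⟩ := hex
  have hmem : s ∈ {T : ℕ | ∀ x : Ω, ∀ t : ℕ, T ≤ t →
      (1 / 2) * ∑ y : Ω, |(P ^ t) x y - π y| ≤ 1 / 4} := fun x t hst => by
    linarith [h.sum_abs_sub_antitone hst x, hs x]
  have := Nat.sInf_mem ⟨s, hmem⟩ x _ le_rfl
  change (1 / 2) * ∑ y : Ω, |(P ^ mixingTime P π) x y - π y| ≤ 1 / 4 at this
  linarith

lemma mixingTime_pos [Nontrivial Ω] (h : IsReversibleChain P π)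
    (hex : ∃ s : ℕ, ∀ x, ∑ y, |(P ^ s) x y - π y| ≤ 1 / 2) : 0 < mixingTime P π := by
  rw [Nat.pos_iff_ne_zero]
  intro h0
  have h1 := h.sum_abs_sub_mixingTime_le hex
  rw [h0, pow_zero] at h1
  obtain ⟨a, b, hab⟩ := exists_pair_ne Ω
  have key : ∀ a b : Ω, a ≠ b → 1 - π a + π b ≤ 1 / 2 := by
    intro a b hab
    calc 1 - π a + π b ≤ |(1 : Matrix Ω Ω ℝ) a a - π a| + |(1 : Matrix Ω Ω ℝ) a b - π b| := by
          rw [Matrix.one_apply_eq, Matrix.one_apply_ne hab, zero_sub, abs_neg]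
          exact add_le_add (le_abs_self _) (le_abs_self _)
      _ = ∑ y ∈ {a, b}, |(1 : Matrix Ω Ω ℝ) a y - π y| := by rw [Finset.sum_pair hab]
      _ ≤ ∑ y, |(1 : Matrix Ω Ω ℝ) a y - π y| :=
          Finset.sum_le_sum_of_subset_of_nonneg (subset_univ _) fun _ _ _ => abs_nonneg _
      _ ≤ 1 / 2 := h1 a
  linarith [key a b hab, key b a hab.symm]

/-- A chain that is close to a well mixed chain is itself well mixed. -/
lemma sum_abs_sub_le_of_close (hP : IsReversibleChain P π) (hQ : IsReversibleChain Q ρ) {δ : ℝ}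
    (hδ : ∀ x, ∑ y, |P x y - Q x y| ≤ δ) {s : ℕ} (hsδ : s * δ ≤ 1 / 8)
    (hs : ∀ x, ∑ y, |(Q ^ s) x y - ρ y| ≤ 1 / 8) (x : Ω) :
    ∑ y, |(P ^ s) x y - π y| ≤ 1 / 2 := by
  have h1 : ∀ x, ∑ y, |(P ^ s) x y - ρ y| ≤ 1 / 4 := by
    intro x
    calc _ ≤ ∑ y, (|(P ^ s) x y - (Q ^ s) x y| + |(Q ^ s) x y - ρ y|) :=
          Finset.sum_le_sum fun y _ => abs_sub_le _ _ _
      _ ≤ 1 / 4 := by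
          rw [Finset.sum_add_distrib]
          linarith [sum_abs_pow_sub_pow_le hP hQ hδ s x, hs x]
  have h2 : ∑ y, |ρ y - π y| ≤ 1 / 4 := by
    have e : ∀ y, ρ y - π y = ∑ x, π x * (ρ y - (P ^ s) x y) := by
      intro y
      simp only [mul_sub, Finset.sum_sub_distrib, (hP.pow s).stationary, ← Finset.sum_mul,
        hP.sum_eq_one, one_mul]
    calc ∑ y, |ρ y - π y| ≤ ∑ y, ∑ x, π x * |(P ^ s) x y - ρ y| := by
          refine Finset.sum_le_sum fun y _ => ?_
          rw [e]
          refine (Finset.abs_sum_le_sum_abs _ _).trans (le_of_eq ?_)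
          exact Finset.sum_congr rfl fun x _ => by
            rw [abs_mul, abs_of_pos (hP.pos x), abs_sub_comm]
      _ = ∑ x, π x * ∑ y, |(P ^ s) x y - ρ y| := by
          rw [Finset.sum_comm]; simp only [Finset.mul_sum]
      _ ≤ ∑ x, π x * (1 / 4) :=
          Finset.sum_le_sum fun x _ => mul_le_mul_of_nonneg_left (h1 x) (hP.pos x).le
      _ = 1 / 4 := by rw [← Finset.sum_mul, hP.sum_eq_one, one_mul]
  calc _ ≤ ∑ y, (|(P ^ s) x y - ρ y| + |ρ y - π y|) :=
        Finset.sum_le_sum fun y _ => abs_sub_le _ _ _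
    _ ≤ 1 / 2 := by
        rw [Finset.sum_add_distrib]; linarith [h1 x]

/-- A chain that is close to a well mixed chain satisfies a Poincaré inequality. -/
lemma chainVar_le_of_close (hP : IsReversibleChain P π) (hQ : IsReversibleChain Q ρ) {δ : ℝ}
    (hδ : ∀ x, ∑ y, |P x y - Q x y| ≤ δ) {t : ℕ} (ht : 0 < t) (htδ : t * δ ≤ 1 / 4)
    (hs : ∀ x, ∑ y, |(P ^ t) x y - π y| ≤ 1 / 2) (f : Ω → ℝ) :
    chainVar ρ f ≤ 4 * t * chainEnergy Q ρ f := by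
  refine hQ.gap_of_contraction ht (fun x y => ?_) f
  have hx := sum_abs_pow_sub_pow_le hP hQ hδ t x
  have hy := sum_abs_pow_sub_pow_le hP hQ hδ t y
  calc ∑ z, |(Q ^ t) x z - (Q ^ t) y z|
      ≤ ∑ z, (|(P ^ t) x z - (Q ^ t) x z| + |(P ^ t) x z - π z|
        + (|(P ^ t) y z - π z| + |(P ^ t) y z - (Q ^ t) y z|)) := by
        refine Finset.sum_le_sum fun z _ => ?_
        have h1 := abs_sub_le ((Q ^ t) x z) ((P ^ t) x z) (π z)
        have h2 := abs_sub_le ((Q ^ t) y z) ((P ^ t) y z) (π z)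
        have h3 := abs_sub_le ((Q ^ t) x z) (π z) ((Q ^ t) y z)
        rw [abs_sub_comm ((Q ^ t) x z) ((P ^ t) x z)] at h1
        rw [abs_sub_comm ((Q ^ t) y z) ((P ^ t) y z), abs_sub_comm ((Q ^ t) y z) (π z)] at h2
        linarith
    _ ≤ 3 / 2 := by
        simp only [Finset.sum_add_distrib]
        linarith [hs x, hs y]

end IsReversibleChain

namespace IsLeague

variable {n : ℕ} {q δ : ℝ} {p p' : ℕ → ℕ → ℝ} {I : ℕ → ℕ → ℕ × ℕ}

lemma sum_abs_swapStep_sub_le (hδ : ∀ u v, u < v → v < n → |p u v - p' u v| ≤ δ)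
    (σ : Equiv.Perm (Fin n)) {i j : Fin n} (hij : i < j) :
    ∑ τ, |swapStep p σ τ i j - swapStep p' σ τ i j| ≤ 2 * δ := by
  have hne : (σ i : ℕ) ≠ σ j := fun c => hij.ne (σ.injective (Fin.ext c))
  have h1 := hδ _ _ (min_lt_max.2 hne) (max_lt (σ i).2 (σ j).2)
  set a := if (σ i : ℕ) ≤ (σ j : ℕ) then σ else σ * Equiv.swap i j with ha
  set b := if (σ i : ℕ) ≤ (σ j : ℕ) then σ * Equiv.swap i j else σ with hb
  set d := p (min (σ i : ℕ) (σ j)) (max (σ i : ℕ) (σ j))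
    - p' (min (σ i : ℕ) (σ j)) (max (σ i : ℕ) (σ j)) with hd
  calc ∑ τ, |swapStep p σ τ i j - swapStep p' σ τ i j|
      ≤ ∑ τ, |d| * ((if τ = a then 1 else 0) + (if τ = b then 1 else 0)) := by
        refine Finset.sum_le_sum fun τ _ => ?_
        have e : swapStep p σ τ i j - swapStep p' σ τ i j
            = d * ((if τ = a then 1 else 0) - (if τ = b then 1 else 0)) := by
          simp only [swapStep, ← ha, ← hb, hd]; ring
        rw [e, abs_mul]
        refine mul_le_mul_of_nonneg_left ?_ (abs_nonneg _)
        split_ifs <;> norm_num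
    _ = 2 * |d| := by
        rw [← Finset.mul_sum, Finset.sum_add_distrib]; simp; ring
    _ ≤ 2 * δ := by linarith

lemma sum_abs_heatBath_sub_le (h : IsLeague n q p I) (h' : IsLeague n q p' I)
    (hδ0 : 0 ≤ δ) (hδ : ∀ u v, u < v → v < n → |p u v - p' u v| ≤ δ)
    (σ : Equiv.Perm (Fin n)) {e : Fin n × Fin n} (he : e ∈ ltPairs n) :
    ∑ τ, |heatBath (inversionPi p) (swapMove I e) σ τ
      - heatBath (inversionPi p') (swapMove I e) σ τ| ≤ 2 * δ := by
  have hlt : e.1 < e.2 := by simpa [ltPairs] using he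
  by_cases hu : Unblocked I σ e.1 e.2
  · simp_rw [← h.swapStep_eq_heatBath σ _ hlt hu, ← h'.swapStep_eq_heatBath σ _ hlt hu]
    exact sum_abs_swapStep_sub_le hδ σ hlt
  · have hm : swapMove I e σ = σ := if_neg hu
    have p1 := h.inversionPi_pos σ
    have p2 := h'.inversionPi_pos σ
    have e0 : ∀ τ, heatBath (inversionPi p) (swapMove I e) σ τ
        = heatBath (inversionPi p') (swapMove I e) σ τ := by
      intro τ
      simp only [heatBath, hm]
      split_ifs
      · field_simp
      · simp
    simp only [e0, sub_self, abs_zero, Finset.sum_const_zero]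
    linarith

lemma sum_abs_heatBathChain_sub_le (h : IsLeague n q p I) (h' : IsLeague n q p' I)
    (hδ0 : 0 ≤ δ) (hδ : ∀ u v, u < v → v < n → |p u v - p' u v| ≤ δ)
    {S : Finset (Fin n × Fin n)} (hS : S ⊆ ltPairs n) (hne : S.Nonempty)
    (σ : Equiv.Perm (Fin n)) :
    ∑ τ, |heatBathChain S (inversionPi p) (swapMove I) σ τ
      - heatBathChain S (inversionPi p') (swapMove I) σ τ| ≤ 2 * δ := by
  have hc : (0 : ℝ) < #S := by exact_mod_cast hne.card_pos
  calc _ ≤ ∑ τ, (1 / (#S : ℝ)) * ∑ e ∈ S, |heatBath (inversionPi p) (swapMove I e) σ τ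
        - heatBath (inversionPi p') (swapMove I e) σ τ| := by
        refine Finset.sum_le_sum fun τ _ => ?_
        rw [heatBathChain, heatBathChain, ← mul_sub, ← Finset.sum_sub_distrib, abs_mul,
          abs_of_pos (by positivity)]
        gcongr
        exact Finset.abs_sum_le_sum_abs _ _
    _ = (1 / (#S : ℝ)) * ∑ e ∈ S, ∑ τ, |heatBath (inversionPi p) (swapMove I e) σ τ
        - heatBath (inversionPi p') (swapMove I e) σ τ| := by
        rw [← Finset.mul_sum, Finset.sum_comm]
    _ ≤ (1 / (#S : ℝ)) * ∑ e ∈ S, 2 * δ := by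
        gcongr with e he
        exact h.sum_abs_heatBath_sub_le h' hδ0 hδ σ (hS he)
    _ = 2 * δ := by
        rw [Finset.sum_const, nsmul_eq_mul]; field_simp

/-- If no swap probability exceeds `1 - δ`, then no permutation is too unlikely. -/
lemma one_div_inversionPi_le (h : IsLeague n q p I) (hq : q ≤ 1) (hδ0 : 0 < δ) (hδ1 : δ ≤ 1)
    (hδ : ∀ u v, u < v → v < n → p u v ≤ 1 - δ) (σ : Equiv.Perm (Fin n)) :
    1 / inversionPi p σ ≤ n.factorial / δ ^ n ^ 2 := by
  have hodds : ∀ u v, u < v → v < n → δ ≤ (1 - p u v) / p u v ∧ (1 - p u v) / p u v ≤ 1 := by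
    intro u v h1 h2
    have h3 := h.pos u v h1 h2
    have h4 := h.lt_one u v h1 h2
    have h5 := h.ratio u v h1 h2
    have h6 := hδ u v h1 h2
    constructor
    · rw [le_div_iff₀ h3]; nlinarith
    · rw [div_le_one h3]; nlinarith
  have hfac : ∀ x : Fin n × Fin n, ∀ τ : Equiv.Perm (Fin n),
      δ ≤ (if x.1 < x.2 then pairWeight p (τ x.1) (τ x.2) else 1) ∧
        (if x.1 < x.2 then pairWeight p (τ x.1) (τ x.2) else 1) ≤ 1 := by
    intro x τ
    unfold pairWeight
    split_ifs with h1 h2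
    · exact hodds _ _ h2 (τ x.1).2
    · exact ⟨hδ1, le_rfl⟩
    · exact ⟨hδ1, le_rfl⟩
  have h1 : δ ^ n ^ 2 ≤ inversionWeight p σ := by
    rw [inversionWeight_eq]
    calc δ ^ n ^ 2 = ∏ x : Fin n × Fin n, δ := by simp [sq]
      _ ≤ _ := Finset.prod_le_prod (fun _ _ => hδ0.le) fun x _ => (hfac x σ).1
  have h2 : ∑ τ : Equiv.Perm (Fin n), inversionWeight p τ ≤ n.factorial := by
    calc ∑ τ : Equiv.Perm (Fin n), inversionWeight p τ ≤ ∑ τ : Equiv.Perm (Fin n), (1 : ℝ) := by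
          refine Finset.sum_le_sum fun τ _ => ?_
          rw [inversionWeight_eq]
          exact Finset.prod_le_one (fun x _ => hδ0.le.trans (hfac x τ).1) fun x _ => (hfac x τ).2
      _ = _ := by simp [Fintype.card_perm]
  rw [inversionPi, one_div_div]
  have := h.inversionWeight_pos σ
  gcongr

end IsLeague

/-- The size of the perturbation of the swap probabilities on `n` labels. -/
noncomputable def capLevel (n : ℕ) : ℝ := (Real.exp (n ^ 2) ^ 15)⁻¹

lemma capLevel_pos (n : ℕ) : 0 < capLevel n := by unfold capLevel; positivity

lemma two_pow_le_exp (k : ℕ) : (2 : ℝ) ^ k ≤ Real.exp k := by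
  rw [← Real.exp_one_pow]
  gcongr
  linarith [Real.add_one_le_exp 1]

lemma sixteen_le_exp_sq {n : ℕ} (hn : 2 ≤ n) : (16 : ℝ) ≤ Real.exp (n ^ 2) := by
  have h1 := two_pow_le_exp 4
  have h2 : Real.exp ((4 : ℕ) : ℝ) ≤ Real.exp (n ^ 2) := by
    rw [Real.exp_le_exp]
    have : (2 : ℝ) ≤ n := by exact_mod_cast hn
    push_cast
    nlinarith
  norm_num at h1
  push_cast at h2
  linarith

lemma natCast_le_exp_sq (n : ℕ) : (n : ℝ) ≤ Real.exp (n ^ 2) := by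
  have h1 : (n : ℝ) ≤ n ^ 2 := by exact_mod_cast Nat.le_self_pow two_ne_zero n
  linarith [Real.add_one_le_exp ((n : ℝ) ^ 2)]

lemma factorial_le_exp_sq (n : ℕ) : (n.factorial : ℝ) ≤ Real.exp (n ^ 2) := by
  calc (n.factorial : ℝ) ≤ (n : ℝ) ^ n := by exact_mod_cast n.factorial_le_pow
    _ ≤ Real.exp n ^ n := by
        gcongr
        linarith [Real.add_one_le_exp (n : ℝ)]
    _ = Real.exp (n ^ 2) := by rw [← Real.exp_nat_mul, sq]

lemma capLevel_le {n : ℕ} (hn : 2 ≤ n) : capLevel n ≤ 1 / 8 := by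
  unfold capLevel
  have h1 := sixteen_le_exp_sq hn
  rw [one_div]
  gcongr
  calc (8 : ℝ) ≤ Real.exp (n ^ 2) ^ 1 := by linarith
    _ ≤ _ := pow_le_pow_right₀ (by linarith) (by norm_num)

/-- Number of relaxation times needed by the adjacent chain to mix. -/
noncomputable def mixingFactor (n : ℕ) : ℝ := 15 * n ^ 4 + n ^ 2 + 6

lemma mixingFactor_le {n : ℕ} (hn : 2 ≤ n) : mixingFactor n ≤ 22 * n ^ 4 := by
  unfold mixingFactor
  have : (2 : ℝ) ≤ n := by exact_mod_cast hn
  have h2 : (4 : ℝ) ≤ (n : ℝ) ^ 2 := by nlinarith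
  nlinarith

lemma mixingFactor_pos (n : ℕ) : 0 < mixingFactor n := by unfold mixingFactor; positivity

lemma capLevel_mul_le {n : ℕ} (hn : 2 ≤ n) :
    (4 * (n.factorial : ℝ) * n ^ 7 * mixingFactor n + 1) * capLevel n ≤ 1 / 16 := by
  have h1 := sixteen_le_exp_sq hn
  have h2 := natCast_le_exp_sq n
  have h3 := factorial_le_exp_sq n
  have h4 := mixingFactor_le hn
  unfold capLevel
  set E := Real.exp (n ^ 2)
  rw [← div_eq_mul_inv, div_le_iff₀ (by positivity)]
  have h5 : (1 : ℝ) ≤ E ^ 12 := one_le_pow₀ (by linarith)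
  have h6 : (16 : ℝ) ^ 3 ≤ E ^ 3 := by gcongr
  calc 4 * (n.factorial : ℝ) * n ^ 7 * mixingFactor n + 1
      ≤ 4 * E * E ^ 7 * (22 * E ^ 4) + E ^ 12 := by
        have : 0 ≤ mixingFactor n := (mixingFactor_pos n).le
        gcongr
        exact h4.trans (by gcongr)
    _ = 89 * E ^ 12 := by ring
    _ ≤ 1 / 16 * E ^ 3 * E ^ 12 := by gcongr; linarith
    _ = 1 / 16 * E ^ 15 := by ring

namespace IsLeague

variable {n : ℕ} {q : ℝ} {p : ℕ → ℕ → ℝ} {I : ℕ → ℕ → ℕ × ℕ}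

lemma one_div_inversionPi_le_exp (h : IsLeague n q p I) (hn : 2 ≤ n) (hq : q ≤ 1)
    (hδ : ∀ u v, u < v → v < n → p u v ≤ 1 - capLevel n) (σ : Equiv.Perm (Fin n)) :
    1 / inversionPi p σ ≤ Real.exp (mixingFactor n - 6) := by
  have h1 := h.one_div_inversionPi_le hq (capLevel_pos n)
    ((capLevel_le hn).trans (by norm_num)) hδ σ
  calc _ ≤ _ := h1
    _ = n.factorial * (Real.exp (n ^ 2) ^ 15) ^ n ^ 2 := by
        rw [capLevel, inv_pow, div_inv_eq_mul]
    _ ≤ Real.exp (n ^ 2) * (Real.exp (n ^ 2) ^ 15) ^ n ^ 2 := by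
        gcongr
        exact factorial_le_exp_sq n
    _ = _ := by
        rw [← pow_mul, ← Real.exp_nat_mul, ← Real.exp_add, mixingFactor]
        congr 1
        push_cast
        ring

lemma adjacentChain_psd (h : IsLeague n q p I) (hn : 2 ≤ n) (f : Equiv.Perm (Fin n) → ℝ) :
    ∑ x, inversionPi p x * ((adjacentChain n p).mulVec f) x ^ 2
      ≤ ∑ x, inversionPi p x * (f x * ((adjacentChain n p).mulVec f) x) := by
  rw [h.adjacentChain_eq (by omega)]
  exact heatBathChain_psd h.inversionPi_pos (adjacentPairs_nonempty hn) (swapMove_involutive I) f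

lemma unblockedChain_psd (h : IsLeague n q p I) (hn : 2 ≤ n) (f : Equiv.Perm (Fin n) → ℝ) :
    ∑ x, inversionPi p x * ((unblockedChain n p I).mulVec f) x ^ 2
      ≤ ∑ x, inversionPi p x * (f x * ((unblockedChain n p I).mulVec f) x) := by
  rw [h.unblockedChain_eq]
  exact heatBathChain_psd h.inversionPi_pos (ltPairs_nonempty hn) (swapMove_involutive I) f

lemma sum_abs_adjacentChain_sub_le (h : IsLeague n q p I) (hn : 2 ≤ n) (hq : q ≤ 1)
    (hδ : ∀ u v, u < v → v < n → p u v ≤ 1 - capLevel n) {R : ℝ} (hR : 0 < R)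
    (hgap : ∀ f, chainVar (inversionPi p) f
      ≤ R * chainEnergy (adjacentChain n p) (inversionPi p) f)
    {s : ℕ} (hs : R * mixingFactor n ≤ s) (σ : Equiv.Perm (Fin n)) :
    ∑ τ, |(adjacentChain n p ^ s) σ τ - inversionPi p τ| ≤ 1 / 8 := by
  have h1 := (h.adjacentChain_isReversibleChain hn).sum_abs_sub_le_of_gap
    (h.adjacentChain_psd hn) hR hgap σ s
  have h2 := h.one_div_inversionPi_le_exp hn hq hδ σ
  have h3 : Real.exp (-s / R) ≤ Real.exp (-mixingFactor n) := by
    rw [Real.exp_le_exp, neg_div, neg_le_neg_iff, le_div_iff₀ hR, mul_comm]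
    exact hs
  have h4 : Real.exp (-s / R) / inversionPi p σ ≤ (1 / 8) ^ 2 := by
    rw [div_eq_mul_one_div]
    calc _ ≤ Real.exp (-mixingFactor n) * Real.exp (mixingFactor n - 6) :=
          mul_le_mul h3 h2 (one_div_pos.2 (h.inversionPi_pos σ)).le (Real.exp_pos _).le
      _ = (Real.exp ((6 : ℕ) : ℝ))⁻¹ := by
          rw [← Real.exp_add, ← Real.exp_neg]; congr 1; push_cast; ring
      _ ≤ (2 ^ 6)⁻¹ := by gcongr; exact two_pow_le_exp 6
      _ = _ := by norm_num
  exact le_of_sq_le_sq (h1.trans h4) (by norm_num)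

/-- If capping the swap probabilities preserves the league structure, then the mixing time of the
adjacent chain is controlled by the mixing time of the chain of unblocked swaps. -/
theorem mixingTime_adjacentChain_le (h : IsLeague n q p I)
    (h' : IsLeague n q (fun u v => min (p u v) (1 - capLevel n)) I) (hn : 2 ≤ n) (hq0 : 0 < q)
    (hq : q < 1 / 2) :
    (mixingTime (adjacentChain n p) (inversionPi p) : ℝ) ≤
      (176 * comparisonConst q + 1) * (n : ℝ) ^ 4
        * (mixingTime (unblockedChain n p I) (inversionPi p) : ℝ) := by
  have hn0 : (2 : ℝ) ≤ n := by exact_mod_cast hn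
  have hC := comparisonConst_pos hq0 hq
  have : Nontrivial (Equiv.Perm (Fin n)) := by
    have : Nontrivial (Fin n) := Fin.nontrivial_iff_two_le.2 hn
    infer_instance
  set δ := capLevel n with hδdef
  have hδ0 : 0 < δ := capLevel_pos n
  set p' : ℕ → ℕ → ℝ := fun u v => min (p u v) (1 - δ) with hp'
  have hcap : ∀ u v, u < v → v < n → p' u v ≤ 1 - δ := fun u v _ _ => min_le_right _ _
  have hclose : ∀ u v, u < v → v < n → |p u v - p' u v| ≤ δ := by
    intro u v h1 h2
    have h3 := h.lt_one u v h1 h2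
    simp only [hp']
    rcases min_cases (p u v) (1 - δ) with ⟨e, -⟩ | ⟨e, h4⟩ <;> rw [e]
    · simpa using hδ0.le
    · rw [abs_of_nonneg (by linarith)]; linarith
  have hA := h.adjacentChain_isReversibleChain hn
  have hA' := h'.adjacentChain_isReversibleChain hn
  have hM := h.unblockedChain_isReversibleChain hn
  have hM' := h'.unblockedChain_isReversibleChain hn
  have hAclose : ∀ σ, ∑ τ, |adjacentChain n p σ τ - adjacentChain n p' σ τ| ≤ 2 * δ := by
    rw [h.adjacentChain_eq (by omega), h'.adjacentChain_eq (by omega)]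
    exact h.sum_abs_heatBathChain_sub_le h' hδ0.le hclose (adjacentPairs_subset_ltPairs n)
      (adjacentPairs_nonempty hn)
  have hMclose : ∀ σ, ∑ τ, |unblockedChain n p I σ τ - unblockedChain n p' I σ τ| ≤ 2 * δ := by
    rw [h.unblockedChain_eq, h'.unblockedChain_eq]
    exact h.sum_abs_heatBathChain_sub_le h' hδ0.le hclose subset_rfl (ltPairs_nonempty hn)
  have hfac : (0 : ℝ) < n.factorial := by exact_mod_cast n.factorial_pos
  have hex := hM.exists_sum_abs_sub_le (h.unblockedChain_psd hn)
    (R := 2 * (n.factorial : ℝ) * n ^ 8) (by positivity) (h.chainVar_le_unblockedChain hn hq)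
  have hmix := hM.sum_abs_sub_mixingTime_le hex
  have ht := hM.mixingTime_pos hex
  set t := mixingTime (unblockedChain n p I) (inversionPi p)
  have ht1 : (1 : ℝ) ≤ t := by exact_mod_cast ht
  set B := 4 * (n.factorial : ℝ) * n ^ 7 with hB
  have hB0 : 0 < B := by positivity
  have hsmall : (B * mixingFactor n + 1) * δ ≤ 1 / 16 := capLevel_mul_le hn
  have hF := mixingFactor_pos n
  have hbound : ∀ R : ℝ, 0 < R → R ≤ B → (∀ f, chainVar (inversionPi p') f
      ≤ R * chainEnergy (adjacentChain n p') (inversionPi p') f) →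
      (mixingTime (adjacentChain n p) (inversionPi p) : ℝ) ≤ ⌈R * mixingFactor n⌉₊ ∧
      (⌈R * mixingFactor n⌉₊ : ℝ) * δ ≤ 1 / 16 := by
    intro R hR hRB hgap
    have h1 : (⌈R * mixingFactor n⌉₊ : ℝ) ≤ B * mixingFactor n + 1 := by
      refine (Nat.ceil_lt_add_one (by positivity)).le.trans ?_
      gcongr
    have h2 : (⌈R * mixingFactor n⌉₊ : ℝ) * δ ≤ 1 / 16 :=
      (mul_le_mul_of_nonneg_right h1 hδ0.le).trans hsmall
    refine ⟨?_, h2⟩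
    exact_mod_cast hA.mixingTime_le (hA.sum_abs_sub_le_of_close hA' hAclose (by linarith)
      (h'.sum_abs_adjacentChain_sub_le hn (by linarith) hcap hR hgap (Nat.le_ceil _)))
  have hgapB := h'.chainVar_le_adjacentChain hn hq
  have hn4 : (1 : ℝ) ≤ (n : ℝ) ^ 4 := one_le_pow₀ (by linarith)
  rcases le_or_gt (t * (2 * δ)) (1 / 4) with htδ | htδ
  · have hgap' : ∀ f, chainVar (inversionPi p') f ≤ 8 * comparisonConst q * t
        * chainEnergy (adjacentChain n p') (inversionPi p') f := by
      intro f
      calc _ ≤ 4 * t * chainEnergy (unblockedChain n p' I) (inversionPi p') f :=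
            hM.chainVar_le_of_close hM' hMclose ht htδ hmix f
        _ ≤ 4 * t * (2 * comparisonConst q
            * chainEnergy (adjacentChain n p') (inversionPi p') f) := by
            gcongr
            exact h'.chainEnergy_unblockedChain_le hn hq0 hq f
        _ = _ := by ring
    have hR0 : 0 < 8 * comparisonConst q * t := by positivity
    obtain ⟨h1, -⟩ := hbound (min (8 * comparisonConst q * t) B) (lt_min hR0 hB0)
      (min_le_right _ _) fun f => by
        rcases min_choice (8 * comparisonConst q * t) B with e | e <;> rw [e]
        · exact hgap' f
        · exact hgapB f
    calc _ ≤ _ := h1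
      _ ≤ min (8 * comparisonConst q * t) B * mixingFactor n + 1 :=
          (Nat.ceil_lt_add_one (by positivity)).le
      _ ≤ 8 * comparisonConst q * t * (22 * n ^ 4) + n ^ 4 * t := by
          gcongr
          · exact min_le_left _ _
          · exact mixingFactor_le hn
          · nlinarith
      _ = _ := by ring
  · obtain ⟨h1, h2⟩ := hbound B hB0 le_rfl hgapB
    have h3 : (⌈B * mixingFactor n⌉₊ : ℝ) ≤ t := by
      refine le_of_mul_le_mul_right ?_ hδ0
      linarith
    calc _ ≤ (t : ℝ) := h1.trans h3
      _ = 1 * 1 * t := by ring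
      _ ≤ _ := by
        gcongr
        linarith

end IsLeague

/-- The mixing time of the trivial league is `0`, its transition matrix being zero. -/
lemma mixingTime_adjacentChain_one (p : ℕ → ℕ → ℝ) {π : Equiv.Perm (Fin 1) → ℝ}
    (hπ : ∑ σ, π σ = 1) : mixingTime (adjacentChain 1 p) π = 0 := by
  have h0 : adjacentChain 1 p = 0 := by ext σ τ; simp [adjacentChain]
  have hempty : {T : ℕ | ∀ x, ∀ t : ℕ, T ≤ t →
      (1 / 2) * ∑ y, |(adjacentChain 1 p ^ t) x y - π y| ≤ 1 / 4} = ∅ := by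
    rw [Set.eq_empty_iff_forall_notMem]
    intro T hT
    have h1 := hT 1 (T + 1) (Nat.le_succ T)
    have h2 : ∑ y, π y ≤ ∑ y, |π y| := Finset.sum_le_sum fun y _ => le_abs_self _
    simp only [h0, zero_pow (Nat.succ_ne_zero T), Matrix.zero_apply, zero_sub, abs_neg] at h1
    linarith
  rw [mixingTime, hempty, Nat.sInf_empty]

/-- For every `qb < 1/2` there is a constant `C > 0` (depending only
on `qb`, a bound on the ratios of the strengths at internal nodes of `T`) such that
for every valid rooted ternary tree `T` with `n` leaves all of whose strength ratios
are at most `qb`, the league hierarchy chain `L₃` and the chain `M_tree` on `S_n`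
satisfy `t(L₃) ≤ C·n⁴·t(M_tree)`. -/
theorem league_vs_tree_mixing (qb : ℝ) (hqb : qb < 1 / 2) :
    ∃ C : ℝ, 0 < C ∧
      ∀ T : STree, T.Valid → T.RatioBound qb →
        (mixingTime (leagueP T) (treePi T) : ℝ) ≤
          C * (T.numLeaves : ℝ) ^ 4 * (mixingTime (treeP T) (treePi T) : ℝ) := by
  set q := max qb (1 / 4)
  have hq0 : 0 < q := lt_max_of_lt_right (by norm_num)
  have hq : q < 1 / 2 := max_lt hqb (by norm_num)
  have hC := comparisonConst_pos hq0 hq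
  refine ⟨176 * comparisonConst q + 1, by positivity, fun T hV hR => ?_⟩
  have h := STree.isLeague hV hR (le_max_left qb (1 / 4))
  rw [leagueP_eq, treeP_eq, treePi_eq]
  rcases Nat.lt_or_ge T.numLeaves 2 with hn | hn
  · have h1 : T.numLeaves = 1 := by have := T.numLeaves_pos; omega
    have h0 : ∀ n : ℕ, n = 1 → ∀ π : Equiv.Perm (Fin n) → ℝ, ∑ σ, π σ = 1 →
        mixingTime (adjacentChain n T.pSwap) π = 0 := by
      rintro n rfl π hπ
      exact mixingTime_adjacentChain_one T.pSwap hπ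
    rw [h0 _ h1 _ h.sum_inversionPi]
    push_cast
    positivity
  · exact h.mixingTime_adjacentChain_le
      (STree.isLeague_min hV hR (le_max_left qb (1 / 4)) (le_max_right qb (1 / 4))
        (capLevel_pos _) (capLevel_le hn)) hn hq0 hq
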